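/- There exist a positive integer d < 3.9×10⁴, a positive integer n, weights w_1,…,w_d ≥ 0 with ∑_{i=1}^d w_i = 1, and unitary n×n matrices U_1,…,U_d whose random unitary channel Φ satisfies S_min(Φ) > log d − (log d)/(2d). -/

import Mathlib

open scoped BigOperators ComplexOrder
open Matrix

/-- Von Neumann entropy of a (Hermitian) matrix, via its eigenvalues;
`Real.log 0 = 0` gives the convention `0 · log 0 = 0`. -/
noncomputable def vnEntropy {m : Type*} [Fintype m] [DecidableEq m] (ρ : Matrix m m ℂ) : ℝ :=
  if h : ρ.IsHermitian then -∑ i, h.eigenvalues i * Real.log (h.eigenvalues i) else 0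

/-- Minimal output entropy of a channel: infimum of output entropies over density matrices. -/
noncomputable def minOutEntropy {m k : Type*} [Fintype m] [DecidableEq m] [Fintype k]
    [DecidableEq k] (Ψ : Matrix m m ℂ → Matrix k k ℂ) : ℝ :=
  sInf {x : ℝ | ∃ ρ : Matrix m m ℂ, ρ.PosSemidef ∧ ρ.trace = 1 ∧ x = vnEntropy (Ψ ρ)}

/-- The random unitary channel `ρ ↦ ∑ i, w i • U i ρ (U i)ᴴ`. -/
noncomputable def ruChannel {n d : ℕ} (w : Fin d → ℝ) (U : Fin d → Matrix (Fin n) (Fin n) ℂ)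
    (ρ : Matrix (Fin n) (Fin n) ℂ) : Matrix (Fin n) (Fin n) ℂ :=
  ∑ i, (w i : ℂ) • (U i * ρ * (U i)ᴴ)

/-- The complex conjugate channel `ρ ↦ ∑ i, w i • conj (U i) ρ (U i)ᵀ`. -/
noncomputable def conjRuChannel {n d : ℕ} (w : Fin d → ℝ) (U : Fin d → Matrix (Fin n) (Fin n) ℂ)
    (ρ : Matrix (Fin n) (Fin n) ℂ) : Matrix (Fin n) (Fin n) ℂ :=
  ∑ i, (w i : ℂ) • ((U i).map star * ρ * (U i)ᵀ)

open Kronecker in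
/-- The product channel `Φ ⊗ Φ̄` acting on `n² × n²` matrices via Kronecker products. -/
noncomputable def prodChannel {n d : ℕ} (w : Fin d → ℝ) (U : Fin d → Matrix (Fin n) (Fin n) ℂ)
    (ρ : Matrix (Fin n × Fin n) (Fin n × Fin n) ℂ) :
    Matrix (Fin n × Fin n) (Fin n × Fin n) ℂ :=
  ∑ i, ∑ j, ((w i * w j : ℝ) : ℂ) •
    ((U i ⊗ₖ (U j).map star) * ρ * (U i ⊗ₖ (U j).map star)ᴴ)

open MeasureTheory

/-- The quadratic form `g ↦ ∑ i j, P i j ⟪g j, g i⟫` on tuples of vectors. -/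
noncomputable def gramForm {ι : Type*} [Fintype ι] {n : ℕ} (P : Matrix ι ι ℂ)
    (g : ι → EuclideanSpace ℂ (Fin n)) : ℝ :=
  (P * gram ℂ g).trace.re

/-- Recombination of a tuple of vectors by a scalar matrix. -/
noncomputable def tupleMix {ι : Type*} [Fintype ι] {n : ℕ} (W : Matrix ι ι ℂ) :
    (ι → EuclideanSpace ℂ (Fin n)) →ₗ[ℝ] (ι → EuclideanSpace ℂ (Fin n)) where
  toFun g k := ∑ j, W j k • g j
  map_add' x y := by ext1 k; simp [Finset.sum_add_distrib]
  map_smul' c x := by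
    ext1 k
    simp only [Pi.smul_apply, RingHom.id_apply, Finset.smul_sum]
    exact Finset.sum_congr rfl fun j _ => smul_comm _ _ _

section

variable {ι : Type*} [Fintype ι] {n : ℕ}

lemma gram_tupleMix (W : Matrix ι ι ℂ) (g : ι → EuclideanSpace ℂ (Fin n)) :
    gram ℂ (tupleMix W g) = Wᴴ * gram ℂ g * W := by
  ext k l
  simp only [gram_apply, tupleMix, LinearMap.coe_mk, AddHom.coe_mk, mul_apply,
    conjTranspose_apply, sum_inner, inner_sum, inner_smul_left, inner_smul_right, Finset.sum_mul]
  refine Finset.sum_congr rfl fun i _ => ?_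
  rw [Finset.mul_sum]
  refine Finset.sum_congr rfl fun j _ => ?_
  simp only [RCLike.star_def]
  ring

lemma gramForm_diagonal [DecidableEq ι] (p : ι → ℝ) (g : ι → EuclideanSpace ℂ (Fin n)) :
    gramForm (diagonal fun i => (p i : ℂ)) g = ∑ i, p i * ‖g i‖ ^ 2 := by
  simp only [gramForm, trace, diag_apply, diagonal_mul, gram_apply, Complex.re_sum]
  refine Finset.sum_congr rfl fun i _ => ?_
  rw [inner_self_eq_norm_sq_to_K]
  simp [← Complex.ofReal_pow]

lemma gramForm_one [DecidableEq ι] (g : ι → EuclideanSpace ℂ (Fin n)) :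
    gramForm 1 g = ∑ i, ‖g i‖ ^ 2 := by
  simpa using gramForm_diagonal (fun _ => 1) g

lemma gramForm_conj_tupleMix (P W : Matrix ι ι ℂ) (g : ι → EuclideanSpace ℂ (Fin n)) :
    gramForm P (tupleMix W g) = gramForm (W * P * Wᴴ) g := by
  rw [gramForm, gramForm, gram_tupleMix, ← Matrix.mul_assoc, trace_mul_comm]
  simp only [Matrix.mul_assoc]

lemma continuous_gramForm (P : Matrix ι ι ℂ) :
    Continuous fun g : ι → EuclideanSpace ℂ (Fin n) => gramForm P g := by
  have : Continuous fun g : ι → EuclideanSpace ℂ (Fin n) => gram ℂ g :=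
    continuous_matrix fun i j => by simp only [gram_apply]; fun_prop
  unfold gramForm
  fun_prop

variable [DecidableEq ι]

lemma measurePreserving_tupleMix {W : Matrix ι ι ℂ} (hW : W ∈ unitaryGroup ι ℂ) :
    MeasurePreserving (tupleMix (n := n) W) := by
  have hform (g : ι → EuclideanSpace ℂ (Fin n)) : gramForm 1 (tupleMix W g) = gramForm 1 g := by
    rw [gramForm_conj_tupleMix, Matrix.mul_one, ← star_eq_conjTranspose,
      mem_unitaryGroup_iff.1 hW]
  have hinj : Function.Injective (tupleMix (n := n) W) := by
    rw [← LinearMap.ker_eq_bot, LinearMap.ker_eq_bot']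
    intro g hg
    have h0 := hform g
    rw [hg, gramForm_one, gramForm_one] at h0
    simp only [Pi.zero_apply, norm_zero, ne_eq, OfNat.ofNat_ne_zero, not_false_eq_true, zero_pow,
      Finset.sum_const_zero] at h0
    ext1 i
    have := (Finset.sum_eq_zero_iff_of_nonneg (fun i _ => sq_nonneg ‖g i‖)).1 h0.symm i
      (Finset.mem_univ _)
    simpa using this
  have hdet : LinearMap.det (tupleMix (n := n) W) ≠ 0 := by
    have := (LinearEquiv.ofInjectiveEndo _ hinj).isUnit_det'
    exact this.ne_zero
  have : (volume : Measure (ι → EuclideanSpace ℂ (Fin n))).IsAddHaarMeasure :=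
    Measure.pi.isAddHaarMeasure _
  set s : Set (ι → EuclideanSpace ℂ (Fin n)) := {g | gramForm 1 g < 1} with hs
  have hopen : IsOpen s := isOpen_lt (continuous_gramForm 1) continuous_const
  have hpos : volume s ≠ 0 := by
    refine (hopen.measure_pos volume ⟨0, ?_⟩).ne'
    simp [hs, gramForm_one]
  have hbdd : Bornology.IsBounded s := by
    refine (Metric.isBounded_closedBall (x := (0 : ι → EuclideanSpace ℂ (Fin n)))
      (r := 1)).subset fun g hg => ?_
    rw [mem_closedBall_zero_iff, pi_norm_le_iff_of_nonneg zero_le_one]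
    intro i
    have h1 : ‖g i‖ ^ 2 ≤ ∑ i, ‖g i‖ ^ 2 :=
      Finset.single_le_sum (f := fun i => ‖g i‖ ^ 2) (fun i _ => sq_nonneg _) (Finset.mem_univ i)
    rw [hs, Set.mem_ofPred_eq, gramForm_one] at hg
    exact (sq_le_one_iff₀ (norm_nonneg _)).1 (h1.trans hg.le)
  have hpre : tupleMix (n := n) W ⁻¹' s = s := by
    ext g; simp [hs, hform]
  have hone : ENNReal.ofReal |(LinearMap.det (tupleMix (n := n) W))⁻¹| = 1 := by
    have := Measure.addHaar_preimage_linearMap volume hdet s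
    rw [hpre] at this
    exact (ENNReal.mul_left_inj hpos hbdd.measure_lt_top.ne).1 (by rw [← this, one_mul])
  refine ⟨(LinearMap.continuous_of_finiteDimensional _).measurable, ?_⟩
  rw [Measure.map_linearMap_addHaar_eq_smul_addHaar volume hdet, hone, one_smul]

lemma integrable_exp_neg_mul_norm_sq {b : ℝ} (hb : 0 < b) :
    Integrable fun x : EuclideanSpace ℂ (Fin n) => Real.exp (-(b * ‖x‖ ^ 2)) := by
  have := GaussianFourier.integrable_cexp_neg_mul_sq_norm_add (V := EuclideanSpace ℂ (Fin n))
    (b := (b : ℂ)) (by simpa using hb) 0 0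
  refine this.re.congr (Filter.Eventually.of_forall fun x => ?_)
  simp only [zero_mul, add_zero]
  rw [show -(b : ℂ) * (‖x‖ : ℂ) ^ 2 = ((-(b * ‖x‖ ^ 2) : ℝ) : ℂ) by push_cast; ring,
    ← Complex.ofReal_exp]
  exact Complex.ofReal_re _

lemma integral_exp_neg_mul_norm_sq {b : ℝ} (hb : 0 < b) :
    ∫ x : EuclideanSpace ℂ (Fin n), Real.exp (-(b * ‖x‖ ^ 2)) = (Real.pi / b) ^ n := by
  have := GaussianFourier.integral_rexp_neg_mul_sq_norm (V := EuclideanSpace ℂ (Fin n)) hb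
  simp only [neg_mul] at this
  rw [this, show Module.finrank ℝ (EuclideanSpace ℂ (Fin n)) = 2 * n by
    rw [finrank_real_of_complex, finrank_euclideanSpace_fin]]
  rw [← Real.rpow_natCast]
  congr 1
  push_cast; ring

lemma integrable_exp_neg_gramForm {P : Matrix ι ι ℂ} (hP : P.PosDef) :
    Integrable (fun g : ι → EuclideanSpace ℂ (Fin n) => Real.exp (-gramForm P g)) ∧
    ∫ g : ι → EuclideanSpace ℂ (Fin n), Real.exp (-gramForm P g) =
      (Real.pi ^ Fintype.card ι / P.det.re) ^ n := by
  set p := hP.isHermitian.eigenvalues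
  set W : Matrix ι ι ℂ := (hP.isHermitian.eigenvectorUnitary).1
  have hPW : P = W * diagonal (fun i => (p i : ℂ)) * Wᴴ := by
    have := hP.isHermitian.spectral_theorem
    rw [Unitary.conjStarAlgAut_apply] at this
    exact this
  have hW : W ∈ unitaryGroup ι ℂ := hP.isHermitian.eigenvectorUnitary.2
  have hp : ∀ i, 0 < p i := hP.eigenvalues_pos
  have hdet : P.det.re = ∏ i, p i := by
    rw [hP.isHermitian.det_eq_prod_eigenvalues]
    simp only [Complex.coe_algebraMap, ← Complex.ofReal_prod, Complex.ofReal_re]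
    rfl
  have hmp := measurePreserving_tupleMix (n := n) hW
  have hcomp (g : ι → EuclideanSpace ℂ (Fin n)) : Real.exp (-gramForm P g) =
      ∏ i, Real.exp (-(p i * ‖tupleMix W g i‖ ^ 2)) := by
    rw [← Real.exp_sum, hPW, ← gramForm_conj_tupleMix, gramForm_diagonal, Finset.sum_neg_distrib]
  have hint : Integrable fun g : ι → EuclideanSpace ℂ (Fin n) =>
      ∏ i, Real.exp (-(p i * ‖g i‖ ^ 2)) :=
    Integrable.fintype_prod fun i => integrable_exp_neg_mul_norm_sq (hp i)
  simp_rw [hcomp]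
  refine ⟨hmp.integrable_comp_of_integrable hint, ?_⟩
  have hmap := integral_map (μ := volume) hmp.measurable.aemeasurable
    (f := fun g : ι → EuclideanSpace ℂ (Fin n) => ∏ i, Real.exp (-(p i * ‖g i‖ ^ 2)))
    (by rw [hmp.map_eq]; exact hint.aestronglyMeasurable)
  rw [← hmap, hmp.map_eq, volume_pi,
    integral_fintype_prod_eq_prod (fun i (x : EuclideanSpace ℂ (Fin n)) =>
      Real.exp (-(p i * ‖x‖ ^ 2))), hdet]
  simp_rw [fun i => integral_exp_neg_mul_norm_sq (n := n) (hp i)]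
  rw [Finset.prod_pow, Finset.prod_div_distrib, Finset.prod_const, Finset.card_univ]

end

/-- A weighted Jensen inequality for the exponential. -/
lemma exp_neg_mul_integral_le {α : Type*} [MeasurableSpace α] {μ : Measure α} {w R : α → ℝ}
    {c : ℝ} (hw : ∀ x, 0 ≤ w x) (hwi : Integrable w μ) (hwR : Integrable (fun x => w x * R x) μ)
    (hwe : Integrable (fun x => w x * Real.exp (-R x)) μ)
    (hc : ∫ x, w x * R x ∂μ ≤ c * ∫ x, w x ∂μ) :
    Real.exp (-c) * ∫ x, w x ∂μ ≤ ∫ x, w x * Real.exp (-R x) ∂μ := by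
  have hle : ∫ x, Real.exp (-c) * ((1 + c) * w x - w x * R x) ∂μ ≤
      ∫ x, w x * Real.exp (-R x) ∂μ := by
    refine integral_mono (((hwi.const_mul _).sub hwR).const_mul _) hwe fun x => ?_
    have h1 : c - R x + 1 ≤ Real.exp (c - R x) := Real.add_one_le_exp _
    have h2 : Real.exp (-R x) = Real.exp (-c) * Real.exp (c - R x) := by
      rw [← Real.exp_add]; congr 1; ring
    have h3 := mul_le_mul_of_nonneg_left h1 (mul_nonneg (Real.exp_pos (-c)).le (hw x))
    simp only [h2]
    nlinarith [h3]
  refine le_trans ?_ hle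
  rw [integral_const_mul, integral_sub (hwi.const_mul _) hwR, integral_const_mul]
  refine mul_le_mul_of_nonneg_left ?_ (Real.exp_pos _).le
  linarith

lemma exp_neg_sub_le_one_sub {s : ℝ} (hs : |s| ≤ 1 / 5) :
    Real.exp (-s - 2 * s ^ 2) ≤ 1 - s := by
  obtain ⟨h1, h2⟩ := abs_le.1 hs
  have h3 : |-s - 2 * s ^ 2| ≤ 1 := by
    rw [abs_le]; constructor <;> nlinarith
  have h4 := (abs_le.1 (Real.abs_exp_sub_one_sub_id_le h3)).2
  have h5 : (-s - 2 * s ^ 2) ^ 2 ≤ 2 * s ^ 2 := by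
    have : (1 + 2 * s) ^ 2 ≤ 2 := by nlinarith
    nlinarith [mul_le_mul_of_nonneg_left this (sq_nonneg s)]
  linarith

section

variable {ι : Type*} [Fintype ι] [DecidableEq ι] {n : ℕ}

lemma integrable_exp_neg_gramForm_one_add {s : ℝ} (hs : s < 1) (i : ι) :
    Integrable (fun g : ι → EuclideanSpace ℂ (Fin n) =>
      Real.exp (-gramForm 1 g) * Real.exp (s * (‖g i‖ ^ 2 - n))) ∧
    ∫ g : ι → EuclideanSpace ℂ (Fin n),
      Real.exp (-gramForm 1 g) * Real.exp (s * (‖g i‖ ^ 2 - n)) =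
      (Real.pi ^ Fintype.card ι) ^ n * (Real.exp (-s) / (1 - s)) ^ n := by
  set p : ι → ℝ := fun j => if j = i then 1 - s else 1 with hp
  have hppos : ∀ j, 0 < p j := fun j => by
    simp only [hp]; split_ifs <;> linarith
  have hP : (diagonal fun j => (p j : ℂ)).PosDef := by
    rw [posDef_diagonal_iff]
    intro j; exact_mod_cast hppos j
  have hdet : (diagonal fun j => (p j : ℂ)).det.re = 1 - s := by
    rw [det_diagonal, ← Complex.ofReal_prod, Complex.ofReal_re]
    simp [hp, Finset.prod_ite_eq']
  obtain ⟨h1, h2⟩ := integrable_exp_neg_gramForm (n := n) hP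
  have hfun : (fun g : ι → EuclideanSpace ℂ (Fin n) =>
      Real.exp (-gramForm 1 g) * Real.exp (s * (‖g i‖ ^ 2 - n))) =
      fun g => Real.exp (-s) ^ n * Real.exp (-gramForm (diagonal fun j => (p j : ℂ)) g) := by
    ext g
    rw [← Real.exp_nat_mul, ← Real.exp_add, ← Real.exp_add, gramForm_one, gramForm_diagonal]
    congr 1
    have : ∑ j, p j * ‖g j‖ ^ 2 = ∑ j, ‖g j‖ ^ 2 - s * ‖g i‖ ^ 2 := by
      rw [eq_sub_iff_add_eq, ← Finset.add_sum_erase _ _ (Finset.mem_univ i),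
        ← Finset.add_sum_erase _ (fun j => ‖g j‖ ^ 2) (Finset.mem_univ i),
        Finset.sum_congr rfl (g := fun j => ‖g j‖ ^ 2) fun j hj => by
          simp [hp, (Finset.mem_erase.1 hj).1]]
      simp only [hp, if_true]
      ring
    rw [this]; ring
  rw [hfun]
  refine ⟨h1.const_mul _, ?_⟩
  rw [integral_const_mul, h2, hdet]
  rw [← mul_pow, ← mul_pow]
  congr 1
  ring

lemma integral_abs_norm_sq_sub_le (hn : 25 ≤ n) (i : ι) :
    Integrable (fun g : ι → EuclideanSpace ℂ (Fin n) =>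
      Real.exp (-gramForm 1 g) * |‖g i‖ ^ 2 - n|) ∧
    ∫ g : ι → EuclideanSpace ℂ (Fin n), Real.exp (-gramForm 1 g) * |‖g i‖ ^ 2 - n| ≤
      2 * Real.exp 2 * √n * (Real.pi ^ Fintype.card ι) ^ n := by
  have hn' : (25 : ℝ) ≤ n := by exact_mod_cast hn
  have hsq : (5 : ℝ) ≤ √n := Real.le_sqrt_of_sq_le (by norm_num; exact hn)
  have hsqpos : 0 < √(n : ℝ) := by linarith
  set s : ℝ := 1 / √n with hs
  have hs5 : s ≤ 1 / 5 := one_div_le_one_div_of_le (by norm_num) hsq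
  have hspos : 0 < s := by positivity
  have hs2 : s ^ 2 * n = 1 := by
    rw [hs, div_pow, Real.sq_sqrt (by linarith), one_pow, one_div_mul_cancel (by linarith)]
  have key (t : ℝ) (ht : |t| = s) : Integrable (fun g : ι → EuclideanSpace ℂ (Fin n) =>
      Real.exp (-gramForm 1 g) * Real.exp (t * (‖g i‖ ^ 2 - n))) ∧
      ∫ g : ι → EuclideanSpace ℂ (Fin n),
        Real.exp (-gramForm 1 g) * Real.exp (t * (‖g i‖ ^ 2 - n)) ≤
      (Real.pi ^ Fintype.card ι) ^ n * Real.exp 2 := by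
    have ht1 : t < 1 := by linarith [le_abs_self t]
    obtain ⟨h1, h2⟩ := integrable_exp_neg_gramForm_one_add (n := n) ht1 i
    refine ⟨h1, h2.le.trans ?_⟩
    refine mul_le_mul_of_nonneg_left ?_ (by positivity)
    have h3 : Real.exp (-t) / (1 - t) ≤ Real.exp (2 * t ^ 2) := by
      rw [div_le_iff₀ (by linarith)]
      have := mul_le_mul_of_nonneg_left (exp_neg_sub_le_one_sub (s := t) (by rw [ht]; exact hs5))
        (Real.exp_pos (2 * t ^ 2)).le
      rw [← Real.exp_add] at this
      convert! this using 2
      ring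
    calc (Real.exp (-t) / (1 - t)) ^ n ≤ Real.exp (2 * t ^ 2) ^ n :=
          pow_le_pow_left₀ (div_nonneg (Real.exp_pos _).le (by linarith)) h3 n
      _ = Real.exp 2 := by
          rw [← Real.exp_nat_mul, ← sq_abs, ht]
          congr 1
          linarith
  obtain ⟨i1, b1⟩ := key s (abs_of_pos hspos)
  obtain ⟨i2, b2⟩ := key (-s) (by rw [abs_neg, abs_of_pos hspos])
  have hpt (g : ι → EuclideanSpace ℂ (Fin n)) : Real.exp (-gramForm 1 g) * |‖g i‖ ^ 2 - n| ≤
      √n * (Real.exp (-gramForm 1 g) * Real.exp (s * (‖g i‖ ^ 2 - n)) +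
        Real.exp (-gramForm 1 g) * Real.exp (-s * (‖g i‖ ^ 2 - n))) := by
    set D : ℝ := ‖g i‖ ^ 2 - n
    have h1 : s * |D| ≤ Real.exp (s * D) + Real.exp (-s * D) := by
      rcases abs_cases D with ⟨h, _⟩ | ⟨h, _⟩ <;> rw [h]
      · linarith [Real.add_one_le_exp (s * D), Real.exp_pos (-s * D)]
      · linarith [Real.add_one_le_exp (-s * D), Real.exp_pos (s * D)]
    have h2 : √n * s = 1 := by rw [hs]; field_simp
    calc Real.exp (-gramForm 1 g) * |D| = √n * Real.exp (-gramForm 1 g) * (s * |D|) := by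
          linear_combination (-(Real.exp (-gramForm 1 g) * |D|)) * h2
      _ ≤ √n * Real.exp (-gramForm 1 g) * (Real.exp (s * D) + Real.exp (-s * D)) :=
          mul_le_mul_of_nonneg_left h1 (by positivity)
      _ = _ := by ring
  have hbound := (i1.add i2).const_mul √(n : ℝ)
  have hint : Integrable (fun g : ι → EuclideanSpace ℂ (Fin n) =>
      Real.exp (-gramForm 1 g) * |‖g i‖ ^ 2 - n|) := by
    refine hbound.mono' ?_ (Filter.Eventually.of_forall fun g => ?_)
    · have := continuous_gramForm (n := n) (1 : Matrix ι ι ℂ)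
      exact Continuous.aestronglyMeasurable (by fun_prop)
    · rw [Real.norm_of_nonneg (by positivity)]
      exact hpt g
  refine ⟨hint, (integral_mono hint hbound hpt).trans ?_⟩
  simp only [Pi.add_apply]
  rw [integral_const_mul, integral_add i1 i2]
  nlinarith

end

/-- Unitary matrices act on Euclidean space by linear isometries. -/
noncomputable def unitaryAct {n : ℕ} :
    unitaryGroup (Fin n) ℂ ≃* (EuclideanSpace ℂ (Fin n) ≃ₗᵢ[ℂ] EuclideanSpace ℂ (Fin n)) :=
  MulEquiv.trans (Unitary.mapEquiv
    { (toEuclideanCLM (n := Fin n) (𝕜 := ℂ)).toRingEquiv.toMulEquiv with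
      map_star' := map_star (toEuclideanCLM (n := Fin n) (𝕜 := ℂ)) }).toMulEquiv
    (Unitary.linearIsometryEquiv (𝕜 := ℂ) (H := EuclideanSpace ℂ (Fin n)))

lemma exists_unitaryAct_eq {n : ℕ} {x y : EuclideanSpace ℂ (Fin n)} (h : ‖x‖ = ‖y‖) :
    ∃ U : unitaryGroup (Fin n) ℂ, unitaryAct U x = y := by
  suffices ∃ e : EuclideanSpace ℂ (Fin n) ≃ₗᵢ[ℂ] EuclideanSpace ℂ (Fin n), e x = y by
    obtain ⟨e, he⟩ := this
    exact ⟨unitaryAct.symm e, by rwa [MulEquiv.apply_symm_apply]⟩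
  by_cases hx : x = 0
  · refine ⟨LinearIsometryEquiv.refl ℂ _, ?_⟩
    rw [hx, norm_zero] at h
    simp [hx, norm_eq_zero.1 h.symm]
  have hy : y ≠ 0 := by
    rw [← norm_ne_zero_iff, ← h]; exact norm_ne_zero_iff.2 hx
  have hnx := norm_ne_zero_iff.2 hx
  obtain ⟨i⟩ : Nonempty (Fin n) := by
    by_contra hne
    rw [not_nonempty_iff] at hne
    exact hx (Subsingleton.elim _ _)
  have hext (z : EuclideanSpace ℂ (Fin n)) (hz : z ≠ 0) :
      ∃ b : OrthonormalBasis (Fin n) ℂ (EuclideanSpace ℂ (Fin n)),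
        b i = ((‖z‖⁻¹ : ℝ) : ℂ) • z := by
    have hon : Orthonormal ℂ (({i} : Set (Fin n)).domRestrict
        fun _ : Fin n => ((‖z‖⁻¹ : ℝ) : ℂ) • z) := by
      refine ⟨fun j => ?_, fun j k hjk => (hjk (Subsingleton.elim _ _)).elim⟩
      simp [Set.domRestrict, norm_smul, norm_ne_zero_iff.2 hz]
    obtain ⟨b, hb⟩ := hon.exists_orthonormalBasis_extension_of_card_eq (by simp)
    exact ⟨b, hb i rfl⟩
  obtain ⟨b, hb⟩ := hext x hx
  obtain ⟨c, hc⟩ := hext y hy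
  refine ⟨b.equiv c (Equiv.refl _), ?_⟩
  have hxb : x = (‖x‖ : ℂ) • b i := by
    rw [hb, smul_smul, ← Complex.ofReal_mul, mul_inv_cancel₀ hnx]; simp
  rw [hxb, map_smul, OrthonormalBasis.equiv_apply_basis, Equiv.refl_apply, hc, smul_smul, ← h,
    ← Complex.ofReal_mul, mul_inv_cancel₀ hnx]
  simp

/-- Tuples of unitary matrices. -/
def UnitaryTuple (ι : Type*) (n : ℕ) : Type _ := ι → unitaryGroup (Fin n) ℂ

namespace UnitaryTuple
variable {ι : Type*} {n : ℕ}

noncomputable instance : Group (UnitaryTuple ι n) :=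
  inferInstanceAs (Group (ι → unitaryGroup (Fin n) ℂ))

noncomputable instance : TopologicalSpace (UnitaryTuple ι n) :=
  inferInstanceAs (TopologicalSpace (ι → unitaryGroup (Fin n) ℂ))

instance : IsTopologicalGroup (UnitaryTuple ι n) :=
  inferInstanceAs (IsTopologicalGroup (ι → unitaryGroup (Fin n) ℂ))

instance : T2Space (UnitaryTuple ι n) :=
  inferInstanceAs (T2Space (ι → unitaryGroup (Fin n) ℂ))

instance [Finite ι] : SecondCountableTopology (UnitaryTuple ι n) :=
  have : SecondCountableTopology (Matrix (Fin n) (Fin n) ℂ) :=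
    inferInstanceAs (SecondCountableTopology (Fin n → Fin n → ℂ))
  have : SecondCountableTopology (unitaryGroup (Fin n) ℂ) :=
    Topology.IsEmbedding.subtypeVal.secondCountableTopology
  inferInstanceAs (SecondCountableTopology (ι → unitaryGroup (Fin n) ℂ))

lemma isCompact_unitaryGroup :
    IsCompact (unitaryGroup (Fin n) ℂ : Set (Matrix (Fin n) (Fin n) ℂ)) := by
  have h : IsCompact (Set.univ.pi fun _ : Fin n => Set.univ.pi fun _ : Fin n =>
      Metric.closedBall (0 : ℂ) 1) :=
    isCompact_univ_pi fun _ => isCompact_univ_pi fun _ => isCompact_closedBall _ _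
  refine IsCompact.of_isClosed_subset h (isClosed_unitary (R := Matrix (Fin n) (Fin n) ℂ)) ?_
  intro U hU i _ j _
  simpa using entry_norm_bound_of_unitary hU i j

instance : CompactSpace (UnitaryTuple ι n) :=
  have : CompactSpace (unitaryGroup (Fin n) ℂ) :=
    isCompact_iff_compactSpace.1 isCompact_unitaryGroup
  inferInstanceAs (CompactSpace (ι → unitaryGroup (Fin n) ℂ))

noncomputable instance : MeasurableSpace (UnitaryTuple ι n) := borel _

instance : BorelSpace (UnitaryTuple ι n) := ⟨rfl⟩

/-- The Haar probability measure on tuples of unitary matrices. -/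
noncomputable def haar (ι : Type*) (n : ℕ) : Measure (UnitaryTuple ι n) :=
  Measure.haarMeasure ⊤

instance : IsProbabilityMeasure (haar ι n) :=
  ⟨Measure.haarMeasure_self (K₀ := (⊤ : TopologicalSpace.PositiveCompacts (UnitaryTuple ι n)))⟩

instance : (haar ι n).IsMulLeftInvariant :=
  inferInstanceAs (Measure.haarMeasure _).IsMulLeftInvariant

/-- The images of `x` under the inverses of the entries of a tuple. -/
noncomputable def orbit (U : UnitaryTuple ι n) (x : EuclideanSpace ℂ (Fin n)) (i : ι) :
    EuclideanSpace ℂ (Fin n) := unitaryAct (U i)⁻¹ x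

@[simp] lemma norm_orbit (U : UnitaryTuple ι n) (x : EuclideanSpace ℂ (Fin n)) (i : ι) :
    ‖orbit U x i‖ = ‖x‖ := LinearIsometryEquiv.norm_map _ _

lemma orbit_mul (V U : UnitaryTuple ι n) (x : EuclideanSpace ℂ (Fin n)) (i : ι) :
    orbit (V * U) x i = orbit U (unitaryAct (V i)⁻¹ x) i := by
  change unitaryAct (V i * U i)⁻¹ x = unitaryAct (U i)⁻¹ (unitaryAct (V i)⁻¹ x)
  rw [_root_.mul_inv_rev, map_mul]; rfl

lemma continuous_orbit_apply (i : ι) :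
    Continuous fun p : UnitaryTuple ι n × EuclideanSpace ℂ (Fin n) => orbit p.1 p.2 i := by
  have h1 : Continuous fun p : UnitaryTuple ι n × EuclideanSpace ℂ (Fin n) => (p.1 i)⁻¹ :=
    (Continuous.inv (show Continuous fun p : UnitaryTuple ι n × EuclideanSpace ℂ (Fin n) =>
      (p.1 i) from (continuous_apply (A := fun _ : ι => unitaryGroup (Fin n) ℂ) i).comp
      continuous_fst))
  have h2 : Continuous fun p : UnitaryTuple ι n × EuclideanSpace ℂ (Fin n) =>
    ((p.1 i)⁻¹ : unitaryGroup (Fin n) ℂ).1 *ᵥ p.2.ofLp :=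
    (continuous_subtype_val.comp h1).matrix_mulVec
      ((PiLp.continuous_ofLp 2 _).comp continuous_snd)
  exact (PiLp.continuous_toLp 2 _).comp h2

lemma orbit_smul (U : UnitaryTuple ι n) (c : ℂ) (x : EuclideanSpace ℂ (Fin n)) (i : ι) :
    orbit U (c • x) i = c • orbit U x i := map_smul (unitaryAct (U i)⁻¹) c x

lemma orbit_add (U : UnitaryTuple ι n) (x y : EuclideanSpace ℂ (Fin n)) (i : ι) :
    orbit U (x + y) i = orbit U x i + orbit U y i := map_add (unitaryAct (U i)⁻¹) x y

lemma continuous_orbit {X : Type*} [TopologicalSpace X] {u : X → UnitaryTuple ι n}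
    {v : X → EuclideanSpace ℂ (Fin n)} (hu : Continuous u) (hv : Continuous v) (i : ι) :
    Continuous fun p => orbit (u p) (v p) i := by
  have h := Continuous.comp (continuous_orbit_apply i) (hu.prodMk hv)
  exact h

end UnitaryTuple

namespace UnitaryTuple
variable {ι : Type*} [Fintype ι] {n : ℕ}

lemma measurePreserving_slots (U : UnitaryTuple ι n) :
    MeasurePreserving fun (g : ι → EuclideanSpace ℂ (Fin n)) i => orbit U (g i) i := by
  refine volume_preserving_pi fun i => ?_
  exact LinearIsometryEquiv.measurePreserving
    { (unitaryAct (U i)⁻¹).toLinearEquiv.restrictScalars ℝ with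
      norm_map' := fun x => (unitaryAct (U i)⁻¹).norm_map x }

omit [Fintype ι] in
lemma continuous_slots {X : Type*} [TopologicalSpace X] {u : X → UnitaryTuple ι n}
    {g : X → ι → EuclideanSpace ℂ (Fin n)} (hu : Continuous u) (hg : Continuous g) :
    Continuous fun p i => orbit (u p) (g p i) i := by
  refine continuous_pi fun i => ?_
  have h : Continuous fun p => g p i := (continuous_pi_iff.1 hg) i
  exact continuous_orbit hu h i

lemma lintegral_eq_lintegral_orbit {f : (ι → EuclideanSpace ℂ (Fin n)) → ENNReal}
    (hf : Measurable f) {x : EuclideanSpace ℂ (Fin n)} (hx : ‖x‖ = 1) :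
    ∫⁻ g, f g = ∫⁻ U, (∫⁻ g : ι → EuclideanSpace ℂ (Fin n),
      f (fun i => orbit U (((‖g i‖ : ℝ) : ℂ) • x) i)) ∂haar ι n := by
  have h1 (U : UnitaryTuple ι n) : ∫⁻ g, f g = ∫⁻ g : ι → EuclideanSpace ℂ (Fin n),
      f (fun i => orbit U (g i) i) :=
    ((measurePreserving_slots U).lintegral_comp hf).symm
  calc ∫⁻ g, f g = ∫⁻ _ : UnitaryTuple ι n, (∫⁻ g, f g) ∂haar ι n := by simp
    _ = ∫⁻ U, (∫⁻ g : ι → EuclideanSpace ℂ (Fin n), f (fun i => orbit U (g i) i)) ∂haar ι n :=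
        lintegral_congr fun U => h1 U
    _ = ∫⁻ g : ι → EuclideanSpace ℂ (Fin n), (∫⁻ U, f (fun i => orbit U (g i) i) ∂haar ι n) := by
        refine lintegral_lintegral_swap (f := fun (U : UnitaryTuple ι n)
          (g : ι → EuclideanSpace ℂ (Fin n)) => f (fun i => orbit U (g i) i))
          (Measurable.aemeasurable (hf.comp (Continuous.measurable ?_)))
        exact continuous_slots continuous_fst continuous_snd
    _ = ∫⁻ g : ι → EuclideanSpace ℂ (Fin n), (∫⁻ U,
          f (fun i => orbit U (((‖g i‖ : ℝ) : ℂ) • x) i) ∂haar ι n) := by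
        refine lintegral_congr fun g => ?_
        have hV (i : ι) : ∃ V : unitaryGroup (Fin n) ℂ,
            unitaryAct V (((‖g i‖ : ℝ) : ℂ) • x) = g i :=
          exists_unitaryAct_eq (by simp [norm_smul, hx])
        choose V hV using hV
        rw [← lintegral_mul_left_eq_self (μ := haar ι n) (fun U =>
          f (fun i => orbit U (((‖g i‖ : ℝ) : ℂ) • x) i)) (show UnitaryTuple ι n from V)⁻¹]
        refine lintegral_congr fun U => ?_
        congr 1
        ext1 i
        rw [orbit_mul]
        congr 1
        refine (hV i).symm.trans ?_
        change _ = unitaryAct ((V i)⁻¹)⁻¹ _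
        rw [inv_inv]
    _ = _ := by
        refine lintegral_lintegral_swap (f := fun (g : ι → EuclideanSpace ℂ (Fin n))
          (U : UnitaryTuple ι n) => f (fun i => orbit U (((‖g i‖ : ℝ) : ℂ) • x) i))
          (Measurable.aemeasurable (hf.comp (Continuous.measurable ?_)))
        have h : Continuous fun p : (ι → EuclideanSpace ℂ (Fin n)) × UnitaryTuple ι n =>
            fun i => ((‖p.1 i‖ : ℝ) : ℂ) • x := by fun_prop
        have h2 := continuous_slots (continuous_snd (X := ι → EuclideanSpace ℂ (Fin n))) h
        exact h2

end UnitaryTuple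

lemma gramForm_eq_sum {ι : Type*} [Fintype ι] {n : ℕ} (B : Matrix ι ι ℂ)
    (g : ι → EuclideanSpace ℂ (Fin n)) :
    gramForm B g = ∑ i, ∑ j, (B i j * inner ℂ (g j) (g i)).re := by
  simp [gramForm, trace, mul_apply, gram_apply, Complex.re_sum]

lemma gramForm_one_sub {ι : Type*} [Fintype ι] [DecidableEq ι] {n : ℕ} (B : Matrix ι ι ℂ)
    (g : ι → EuclideanSpace ℂ (Fin n)) :
    gramForm (1 - B) g = ∑ i, ‖g i‖ ^ 2 - gramForm B g := by
  rw [← gramForm_one, gramForm, gramForm, gramForm, Matrix.sub_mul, trace_sub, Complex.sub_re]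

lemma abs_mul_sub_le_abs_sq_sub {a b t : ℝ} (ha : 0 ≤ a) (hb : 0 ≤ b) :
    |a * b - t| ≤ |a ^ 2 - t| + |b ^ 2 - t| := by
  have h1 := neg_abs_le (a ^ 2 - t)
  have h2 := neg_abs_le (b ^ 2 - t)
  have h3 := le_abs_self (a ^ 2 - t)
  have h4 := le_abs_self (b ^ 2 - t)
  have h5 := abs_nonneg (a ^ 2 - t)
  have h6 := abs_nonneg (b ^ 2 - t)
  rw [abs_le]
  constructor
  · rcases le_total a b with h | h
    · nlinarith [mul_le_mul_of_nonneg_left h ha]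
    · nlinarith [mul_le_mul_of_nonneg_left h hb]
  · nlinarith [sq_nonneg (a - b)]

namespace UnitaryTuple
variable {ι : Type*} [Fintype ι] {n : ℕ}

omit [Fintype ι] in
lemma norm_inner_orbit_le (U : UnitaryTuple ι n) (x y : EuclideanSpace ℂ (Fin n)) (i j : ι) :
    ‖inner ℂ (orbit U x i) (orbit U y j)‖ ≤ ‖x‖ * ‖y‖ := by
  simpa using norm_inner_le_norm (𝕜 := ℂ) (orbit U x i) (orbit U y j)

lemma continuous_gramForm_orbit {X : Type*} [TopologicalSpace X] {u : X → UnitaryTuple ι n}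
    {v : X → EuclideanSpace ℂ (Fin n)} (hu : Continuous u) (hv : Continuous v)
    (B : Matrix ι ι ℂ) : Continuous fun p => gramForm B (orbit (u p) (v p)) :=
  (continuous_gramForm B).comp (continuous_pi fun i => continuous_orbit hu hv i)

lemma le_gramForm_slots (B : Matrix ι ι ℂ) (U : UnitaryTuple ι n)
    {x : EuclideanSpace ℂ (Fin n)} (hx : ‖x‖ = 1) (a : ι → ℝ) (ha : ∀ i, 0 ≤ a i) :
    n * gramForm B (orbit U x) - ∑ i, ∑ j, ‖B i j‖ * (|a i ^ 2 - n| + |a j ^ 2 - n|) ≤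
      gramForm B (fun i => orbit U ((a i : ℂ) • x) i) := by
  simp only [gramForm_eq_sum, Finset.mul_sum, ← Finset.sum_sub_distrib]
  refine Finset.sum_le_sum fun i _ => Finset.sum_le_sum fun j _ => ?_
  set z := B i j * inner ℂ (orbit U x j) (orbit U x i) with hz
  have h1 : B i j * inner ℂ (orbit U ((a j : ℂ) • x) j) (orbit U ((a i : ℂ) • x) i) =
      ((a i * a j : ℝ) : ℂ) * z := by
    rw [orbit_smul, orbit_smul, inner_smul_left, inner_smul_right, hz]
    simp only [Complex.conj_ofReal, Complex.ofReal_mul]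
    ring
  have h2 : |z.re| ≤ ‖B i j‖ := by
    refine (Complex.abs_re_le_norm z).trans ?_
    rw [hz, norm_mul]
    exact mul_le_of_le_one_right (norm_nonneg _) (by
      simpa [hx] using norm_inner_orbit_le U x x j i)
  rw [h1, Complex.re_ofReal_mul]
  have h3 := abs_mul_sub_le_abs_sq_sub (t := n) (ha i) (ha j)
  have h4 : |(a i * a j - n) * z.re| ≤ ‖B i j‖ * (|a i ^ 2 - n| + |a j ^ 2 - n|) := by
    rw [abs_mul, mul_comm]
    exact mul_le_mul h2 h3 (abs_nonneg _) (norm_nonneg _)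
  have h5 := (abs_le.1 h4).1
  linarith

variable [DecidableEq ι]

lemma integral_exp_gramForm_orbit_le {B : Matrix ι ι ℂ} (hB : (1 - B).PosDef) (hn : 25 ≤ n)
    {x : EuclideanSpace ℂ (Fin n)} (hx : ‖x‖ = 1) :
    ∫ U, Real.exp (n * gramForm B (orbit U x)) ∂haar ι n ≤
      Real.exp (4 * Real.exp 2 * (∑ i, ∑ j, ‖B i j‖) * √n) / (1 - B).det.re ^ n := by
  set c : ℝ := 4 * Real.exp 2 * (∑ i, ∑ j, ‖B i j‖) * √n with hc
  set R : (ι → EuclideanSpace ℂ (Fin n)) → ℝ := fun g =>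
    ∑ i, ∑ j, ‖B i j‖ * (|‖g i‖ ^ 2 - n| + |‖g j‖ ^ 2 - n|) with hR
  set w : (ι → EuclideanSpace ℂ (Fin n)) → ℝ := fun g => Real.exp (-gramForm 1 g) with hw
  obtain ⟨iw, ew⟩ := integrable_exp_neg_gramForm (n := n)
    (PosDef.one : (1 : Matrix ι ι ℂ).PosDef)
  rw [det_one, Complex.one_re, div_one] at ew
  have hwc : Continuous w := by
    have := continuous_gramForm (n := n) (1 : Matrix ι ι ℂ)
    fun_prop
  have hRc : Continuous R := by fun_prop
  have hR0 (g) : 0 ≤ R g := Finset.sum_nonneg fun i _ => Finset.sum_nonneg fun j _ => by positivity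
  have hwRe (g) : w g * R g = ∑ i, ∑ j, (‖B i j‖ * (w g * |‖g i‖ ^ 2 - n|) +
      ‖B i j‖ * (w g * |‖g j‖ ^ 2 - n|)) := by
    simp only [hR, Finset.mul_sum]
    refine Finset.sum_congr rfl fun i _ => Finset.sum_congr rfl fun j _ => by ring
  have hi (i j k : ι) : Integrable fun g => ‖B i j‖ * (w g * |‖g k‖ ^ 2 - n|) :=
    (integral_abs_norm_sq_sub_le hn k).1.const_mul _
  have hii (i j : ι) : Integrable fun g => ‖B i j‖ * (w g * |‖g i‖ ^ 2 - n|) +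
      ‖B i j‖ * (w g * |‖g j‖ ^ 2 - n|) := (hi i j i).add (hi i j j)
  have iwR : Integrable fun g => w g * R g := by
    simp only [hwRe]
    exact integrable_finsetSum _ fun i _ => integrable_finsetSum _ fun j _ => hii i j
  have hwR : ∫ g, w g * R g ≤ c * ∫ g, w g := by
    simp only [hwRe]
    rw [integral_finsetSum _ fun i _ => integrable_finsetSum _ fun j _ => hii i j]
    rw [hc, ew, Finset.mul_sum, Finset.sum_mul, Finset.sum_mul]
    refine Finset.sum_le_sum fun i _ => ?_
    rw [integral_finsetSum _ fun j _ => hii i j, Finset.mul_sum, Finset.sum_mul,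
      Finset.sum_mul]
    refine Finset.sum_le_sum fun j _ => ?_
    rw [integral_add (hi i j i) (hi i j j), integral_const_mul, integral_const_mul]
    have h1 := mul_le_mul_of_nonneg_left (integral_abs_norm_sq_sub_le hn i).2 (norm_nonneg (B i j))
    have h2 := mul_le_mul_of_nonneg_left (integral_abs_norm_sq_sub_le hn j).2 (norm_nonneg (B i j))
    linarith
  have iwe : Integrable fun g => w g * Real.exp (-R g) := by
    refine iw.mono' (by fun_prop) (Filter.Eventually.of_forall fun g => ?_)
    rw [Real.norm_of_nonneg (by positivity)]
    exact mul_le_of_le_one_right (Real.exp_pos _).le (by simpa using hR0 g)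
  have hJ := exp_neg_mul_integral_le (fun g => (Real.exp_pos _).le) iw iwR iwe hwR
  obtain ⟨iP, eP⟩ := integrable_exp_neg_gramForm (n := n) hB
  set F : (ι → EuclideanSpace ℂ (Fin n)) → ENNReal := fun g =>
    ENNReal.ofReal (Real.exp (-gramForm (1 - B) g)) with hF
  have hFm : Measurable F := by
    have := continuous_gramForm (n := n) (1 - B)
    exact ENNReal.measurable_ofReal.comp (Continuous.measurable (by fun_prop))
  have hFe := lintegral_eq_lintegral_orbit hFm hx
  have hL : ∫⁻ g, F g = ENNReal.ofReal ((Real.pi ^ Fintype.card ι / (1 - B).det.re) ^ n) := by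
    rw [← eP, ofReal_integral_eq_lintegral_ofReal iP
      (Filter.Eventually.of_forall fun g => (Real.exp_pos _).le)]
  have hlow (U : UnitaryTuple ι n) :
      ENNReal.ofReal (Real.exp (n * gramForm B (orbit U x)) *
        (Real.exp (-c) * (Real.pi ^ Fintype.card ι) ^ n)) ≤
      ∫⁻ g : ι → EuclideanSpace ℂ (Fin n), F (fun i => orbit U (((‖g i‖ : ℝ) : ℂ) • x) i) := by
    calc _ ≤ ENNReal.ofReal (∫ g, Real.exp (n * gramForm B (orbit U x)) *
          (w g * Real.exp (-R g))) := by
          rw [integral_const_mul, ← ew]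
          exact ENNReal.ofReal_le_ofReal (mul_le_mul_of_nonneg_left hJ (Real.exp_pos _).le)
      _ = ∫⁻ g, ENNReal.ofReal (Real.exp (n * gramForm B (orbit U x)) *
          (w g * Real.exp (-R g))) :=
          ofReal_integral_eq_lintegral_ofReal (iwe.const_mul _)
            (Filter.Eventually.of_forall fun g => by positivity)
      _ ≤ _ := by
          refine lintegral_mono fun g => ENNReal.ofReal_le_ofReal ?_
          rw [hw, ← Real.exp_add, ← Real.exp_add, gramForm_one]
          refine Real.exp_le_exp.2 ?_
          rw [gramForm_one_sub]
          have := le_gramForm_slots B U hx (fun i => ‖g i‖) fun i => norm_nonneg _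
          simp only [norm_orbit, norm_smul, hx, mul_one, Complex.norm_real, norm_norm]
          simp only [hR]
          linarith
  have hcomp : Continuous fun U : UnitaryTuple ι n => Real.exp (n * gramForm B (orbit U x)) := by
    have := continuous_gramForm_orbit (continuous_id (X := UnitaryTuple ι n))
      (continuous_const (y := x)) B
    simp only [id] at this
    fun_prop
  have hint : Integrable (fun U : UnitaryTuple ι n => Real.exp (n * gramForm B (orbit U x)))
      (haar ι n) := hcomp.integrable_of_hasCompactSupport (HasCompactSupport.of_compactSpace _)
  have htot : ENNReal.ofReal (∫ U, Real.exp (n * gramForm B (orbit U x)) *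
        (Real.exp (-c) * (Real.pi ^ Fintype.card ι) ^ n) ∂haar ι n) ≤
      ENNReal.ofReal ((Real.pi ^ Fintype.card ι / (1 - B).det.re) ^ n) := by
    rw [← hL, hFe, ofReal_integral_eq_lintegral_ofReal (hint.mul_const _)
      (Filter.Eventually.of_forall fun g => by positivity)]
    exact lintegral_mono hlow
  have hdet : 0 < (1 - B).det.re := (Complex.lt_def.1 hB.det_pos).1
  rw [ENNReal.ofReal_le_ofReal_iff (by positivity), integral_mul_const, div_pow] at htot
  rw [le_div_iff₀ (by positivity)]
  rw [le_div_iff₀ (by positivity), Real.exp_neg] at htot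
  have hpi : 0 < (Real.pi ^ Fintype.card ι) ^ n := by positivity
  have hec := Real.exp_pos c
  refine le_of_mul_le_mul_right ?_ hpi
  field_simp at htot
  nlinarith

end UnitaryTuple

lemma le_half_sqrt_mul_sq_add {s a : ℝ} (hs : 0 < s) : a ≤ (s * a ^ 2 + 1 / s) / 2 := by
  have h : s * a ^ 2 + 1 / s - 2 * a = (s * a - 1) ^ 2 / s := by field_simp; ring
  have : 0 ≤ (s * a - 1) ^ 2 / s := by positivity
  linarith

namespace UnitaryTuple
variable {ι : Type*} {n : ℕ}

lemma integrable_haar {f : UnitaryTuple ι n → ℝ} (hf : Continuous f) : Integrable f (haar ι n) :=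
  hf.integrable_of_hasCompactSupport (HasCompactSupport.of_compactSpace _)

lemma sum_sq_norm_inner_orbit (U : UnitaryTuple ι n) (i : ι) (y : EuclideanSpace ℂ (Fin n)) :
    ∑ k, ‖inner ℂ (orbit U (EuclideanSpace.single k 1) i) y‖ ^ 2 = ‖y‖ ^ 2 := by
  have := ((EuclideanSpace.basisFun (Fin n) ℂ).map (unitaryAct (U i)⁻¹)).sum_sq_norm_inner_right y
  simp only [OrthonormalBasis.map_apply, EuclideanSpace.basisFun_apply] at this
  exact this

lemma integral_sq_norm_inner_orbit_le (hn : 0 < n) {i j : ι} (hij : i ≠ j)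
    {x y : EuclideanSpace ℂ (Fin n)} (hx : ‖x‖ ≤ 1) (hy : ‖y‖ ≤ 1) :
    ∫ U, ‖inner ℂ (orbit U x i) (orbit U y j)‖ ∂haar ι n ≤ 1 / √n := by
  classical
  have hc (x y : EuclideanSpace ℂ (Fin n)) : Continuous fun U : UnitaryTuple ι n =>
      inner ℂ (orbit U x i) (orbit U y j) :=
    (continuous_orbit continuous_id continuous_const i).inner
      (continuous_orbit continuous_id continuous_const j)
  have hc2 (x y : EuclideanSpace ℂ (Fin n)) : Continuous fun U : UnitaryTuple ι n =>
      ‖inner ℂ (orbit U x i) (orbit U y j)‖ ^ 2 := (hc x y).norm.pow 2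
  have hinv (k : Fin n) : ∫ U, ‖inner ℂ (orbit U x i) (orbit U y j)‖ ^ 2 ∂haar ι n =
      ‖x‖ ^ 2 * ∫ U, ‖inner ℂ (orbit U (EuclideanSpace.single k 1) i) (orbit U y j)‖ ^ 2
        ∂haar ι n := by
    obtain ⟨V, hV⟩ := exists_unitaryAct_eq (x := x)
      (y := ((‖x‖ : ℝ) : ℂ) • EuclideanSpace.single k (1 : ℂ)) (by simp [norm_smul])
    obtain ⟨W, hWi, hWj⟩ : ∃ W : UnitaryTuple ι n, W i = V⁻¹ ∧ W j = 1 :=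
      ⟨Function.update (fun _ => 1 : ι → unitaryGroup (Fin n) ℂ) i V⁻¹,
        Function.update_self _ _ _, Function.update_of_ne hij.symm _ _⟩
    rw [← integral_const_mul, ← integral_mul_left_eq_self _ W]
    refine integral_congr_ae (Filter.Eventually.of_forall fun U => ?_)
    simp only [orbit_mul, hWi, hWj, inv_inv, inv_one, map_one, hV, orbit_smul, inner_smul_left,
      norm_mul, mul_pow]
    simp
  have hsum : (n : ℝ) * ∫ U, ‖inner ℂ (orbit U x i) (orbit U y j)‖ ^ 2 ∂haar ι n =
      ‖x‖ ^ 2 * ‖y‖ ^ 2 := by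
    calc _ = ∑ k : Fin n, ∫ U, ‖inner ℂ (orbit U x i) (orbit U y j)‖ ^ 2 ∂haar ι n := by simp
      _ = ‖x‖ ^ 2 * ∑ k : Fin n, ∫ U, ‖inner ℂ (orbit U (EuclideanSpace.single k 1) i)
            (orbit U y j)‖ ^ 2 ∂haar ι n := by
          rw [Finset.mul_sum]; exact Finset.sum_congr rfl fun k _ => hinv k
      _ = _ := by
          rw [← integral_finsetSum _ fun k _ => integrable_haar (hc2 _ _)]
          simp [sum_sq_norm_inner_orbit]
  have hn' : (0 : ℝ) < n := by exact_mod_cast hn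
  have hs : 0 < √(n : ℝ) := Real.sqrt_pos.2 hn'
  have hle : ∫ U, ‖inner ℂ (orbit U x i) (orbit U y j)‖ ^ 2 ∂haar ι n ≤ 1 / n := by
    rw [le_div_iff₀ hn', mul_comm, hsum]
    exact mul_le_one₀ (pow_le_one₀ (norm_nonneg _) hx) (by positivity)
      (pow_le_one₀ (norm_nonneg _) hy)
  calc _ ≤ ∫ U, (√n * ‖inner ℂ (orbit U x i) (orbit U y j)‖ ^ 2 + 1 / √n) / 2 ∂haar ι n :=
        integral_mono (integrable_haar (hc x y).norm)
          (integrable_haar (by have := hc2 x y; fun_prop)) fun U => le_half_sqrt_mul_sq_add hs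
    _ = (√n * ∫ U, ‖inner ℂ (orbit U x i) (orbit U y j)‖ ^ 2 ∂haar ι n + 1 / √n) / 2 := by
        rw [integral_div, integral_add ((integrable_haar (hc2 x y)).const_mul _)
          (integrable_const _), integral_const_mul]
        simp
    _ ≤ (√n * (1 / n) + 1 / √n) / 2 := by gcongr
    _ = 1 / √n := by
        have : √(n : ℝ) * (1 / n) = 1 / √n := by
          field_simp; exact (Real.sq_sqrt hn'.le)
        rw [this]; ring

end UnitaryTuple

lemma setIntegral_norm_inner_le {n : ℕ} (hn : 0 < n) {ρ : ℝ} (hρ : ρ ≤ 1)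
    {v : EuclideanSpace ℂ (Fin n)} (hv : ‖v‖ ≤ 1) :
    ∫ z in Metric.closedBall (0 : EuclideanSpace ℂ (Fin n)) ρ, ‖inner ℂ v z‖ ≤
      volume.real (Metric.closedBall (0 : EuclideanSpace ℂ (Fin n)) ρ) / √n := by
  set T := Metric.closedBall (0 : EuclideanSpace ℂ (Fin n)) ρ with hT
  have hTc : IsCompact T := isCompact_closedBall _ _
  have hint {f : EuclideanSpace ℂ (Fin n) → ℝ} (hf : Continuous f) : IntegrableOn f T :=
    hf.continuousOn.integrableOn_compact hTc
  have hinv (k : Fin n) : ∫ z in T, ‖inner ℂ v z‖ ^ 2 =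
      ‖v‖ ^ 2 * ∫ z in T, ‖inner ℂ (EuclideanSpace.single k (1 : ℂ)) z‖ ^ 2 := by
    obtain ⟨V, hV⟩ := exists_unitaryAct_eq (x := ((‖v‖ : ℝ) : ℂ) • EuclideanSpace.single k (1 : ℂ))
      (y := v) (by simp [norm_smul])
    have hmp : MeasurePreserving (unitaryAct V) := LinearIsometryEquiv.measurePreserving
      { (unitaryAct V).toLinearEquiv.restrictScalars ℝ with
        norm_map' := fun x => (unitaryAct V).norm_map x }
    have hpre : (unitaryAct V) ⁻¹' T = T := by
      ext z; simp [hT]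
    rw [← integral_const_mul, ← hmp.setIntegral_preimage_emb
      (unitaryAct V).toHomeomorph.measurableEmbedding, hpre]
    refine setIntegral_congr_fun hTc.measurableSet fun z _ => ?_
    rw [← hV, LinearIsometryEquiv.inner_map_map, hV, inner_smul_left, norm_mul, mul_pow]
    simp
  have hsum : (n : ℝ) * ∫ z in T, ‖inner ℂ v z‖ ^ 2 = ‖v‖ ^ 2 * ∫ z in T, ‖z‖ ^ 2 := by
    calc _ = ∑ k : Fin n, ∫ z in T, ‖inner ℂ v z‖ ^ 2 := by simp
      _ = ‖v‖ ^ 2 * ∑ k : Fin n, ∫ z in T, ‖inner ℂ (EuclideanSpace.single k (1 : ℂ)) z‖ ^ 2 := by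
          rw [Finset.mul_sum]; exact Finset.sum_congr rfl fun k _ => hinv k
      _ = _ := by
          rw [← integral_finsetSum _ fun k _ => hint (by fun_prop)]
          congr 2; ext z
          simpa using (EuclideanSpace.basisFun (Fin n) ℂ).sum_sq_norm_inner_right z
  have hn' : (0 : ℝ) < n := by exact_mod_cast hn
  have hs : 0 < √(n : ℝ) := Real.sqrt_pos.2 hn'
  have hz : ∫ z in T, ‖z‖ ^ 2 ≤ volume.real T := by
    calc _ ≤ ∫ z in T, (1 : ℝ) := setIntegral_mono_on (hint (by fun_prop))
            (hint continuous_const) hTc.measurableSet fun z hz =>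
            pow_le_one₀ (norm_nonneg _) ((mem_closedBall_zero_iff.1 hz).trans hρ)
      _ = _ := by simp
  have hle : ∫ z in T, ‖inner ℂ v z‖ ^ 2 ≤ volume.real T / n := by
    rw [le_div_iff₀ hn', mul_comm, hsum]
    have h0 : 0 ≤ ∫ z in T, ‖z‖ ^ 2 := integral_nonneg fun z => by positivity
    have := pow_le_one₀ (n := 2) (norm_nonneg _) hv
    nlinarith
  calc _ ≤ ∫ z in T, (√n * ‖inner ℂ v z‖ ^ 2 + 1 / √n) / 2 :=
        setIntegral_mono_on (hint (by fun_prop)) (hint (by fun_prop)) hTc.measurableSet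
          fun U _ => le_half_sqrt_mul_sq_add hs
    _ = (√n * (∫ z in T, ‖inner ℂ v z‖ ^ 2) + volume.real T * (1 / √n)) / 2 := by
        rw [integral_div, integral_add ((hint (by fun_prop)).const_mul _)
          (hint continuous_const), integral_const_mul]
        simp
    _ ≤ (√n * (volume.real T / n) + volume.real T * (1 / √n)) / 2 := by gcongr
    _ = _ := by
        have : √(n : ℝ) * (volume.real T / n) = volume.real T / √n := by
          field_simp; rw [Real.sq_sqrt hn'.le, mul_comm]
        rw [this]; ring

lemma measureReal_closedBall_sqrt_half (n : ℕ) :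
    volume.real (Metric.closedBall (0 : EuclideanSpace ℂ (Fin n)) √(1 / 2)) =
      (1 / 2) ^ n * volume.real (Metric.closedBall (0 : EuclideanSpace ℂ (Fin n)) 1) := by
  have h := Measure.addHaar_closedBall_mul (volume : Measure (EuclideanSpace ℂ (Fin n))) 0
    (Real.sqrt_nonneg (1 / 2)) (zero_le_one (α := ℝ))
  have hf : Module.finrank ℝ (EuclideanSpace ℂ (Fin n)) = 2 * n := by
    rw [finrank_real_of_complex, finrank_euclideanSpace_fin]
  rw [mul_one, hf, pow_mul, Real.sq_sqrt (by norm_num)] at h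
  rw [Measure.real, h, ENNReal.toReal_mul, ENNReal.toReal_ofReal (by positivity), Measure.real]

lemma measureReal_closedBall_le_two_mul {n : ℕ} (y : EuclideanSpace ℂ (Fin n)) (ρ : ℝ) :
    volume.real (Metric.closedBall (0 : EuclideanSpace ℂ (Fin n)) ρ) ≤
      2 * volume.real (Metric.closedBall (0 : EuclideanSpace ℂ (Fin n)) ρ ∩
        {z | (inner ℂ y z).re ≤ 0}) := by
  set S := Metric.closedBall (0 : EuclideanSpace ℂ (Fin n)) ρ ∩ {z | (inner ℂ y z).re ≤ 0} with hS
  have hSfin : volume S ≠ ⊤ := measure_ne_top_of_subset Set.inter_subset_left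
    (isCompact_closedBall _ _).measure_lt_top.ne
  have hsub : Metric.closedBall (0 : EuclideanSpace ℂ (Fin n)) ρ ⊆ S ∪ -S := by
    intro z hz
    rcases le_total (inner ℂ y z).re 0 with h | h
    · exact Or.inl ⟨hz, h⟩
    · refine Or.inr ⟨?_, ?_⟩
      · simpa using hz
      · simpa using h
  have hneg : volume.real (-S) = volume.real S := by
    rw [Measure.real, Measure.measure_neg, Measure.real]
  calc _ ≤ volume.real (S ∪ -S) := measureReal_mono hsub
        (measure_union_ne_top hSfin (by rwa [Measure.measure_neg]))
    _ ≤ volume.real S + volume.real (-S) := measureReal_union_le _ _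
    _ = _ := by rw [hneg, two_mul]

namespace UnitaryTuple
variable {ι : Type*} [Fintype ι] {n : ℕ}

omit [Fintype ι] in
lemma setIntegral_norm_inner_orbit_le (hn : 0 < n) {ρ : ℝ} (hρ : ρ ≤ 1) (U : UnitaryTuple ι n)
    {v : EuclideanSpace ℂ (Fin n)} (hv : ‖v‖ ≤ 1) (i j : ι) :
    ∫ z in Metric.closedBall (0 : EuclideanSpace ℂ (Fin n)) ρ,
        ‖inner ℂ (orbit U v i) (orbit U z j)‖ ≤
      volume.real (Metric.closedBall (0 : EuclideanSpace ℂ (Fin n)) ρ) / √n := by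
  have h (z : EuclideanSpace ℂ (Fin n)) : inner ℂ (orbit U v i) (orbit U z j) =
      inner ℂ ((unitaryAct (U j)⁻¹).symm (orbit U v i)) z := by
    change inner ℂ (orbit U v i) (unitaryAct (U j)⁻¹ z) = _
    generalize unitaryAct (U j)⁻¹ = e
    rw [← LinearIsometryEquiv.inner_map_map e (e.symm _), LinearIsometryEquiv.apply_symm_apply]
  simp only [h]
  exact setIntegral_norm_inner_le hn hρ (by simpa using hv)

lemma le_gramForm_orbit_add (A : Matrix ι ι ℂ) (U : UnitaryTuple ι n)
    (y z : EuclideanSpace ℂ (Fin n)) :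
    gramForm A (orbit U y) / 2 - ∑ i, ∑ j, ‖A i j‖ * (‖inner ℂ (orbit U y j) (orbit U z i)‖ +
      ‖inner ℂ (orbit U y i) (orbit U z j)‖ + ‖inner ℂ (orbit U z j) (orbit U z i)‖) ≤
    gramForm A (orbit U (((√(1 / 2) : ℝ) : ℂ) • y + z)) := by
  simp only [gramForm_eq_sum, Finset.sum_div, ← Finset.sum_sub_distrib]
  refine Finset.sum_le_sum fun i _ => Finset.sum_le_sum fun j _ => ?_
  set s : ℝ := √(1 / 2) with hs
  have hs0 : 0 ≤ s := Real.sqrt_nonneg _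
  have hss : s * s = 1 / 2 := Real.mul_self_sqrt (by norm_num)
  have hs1 : s ≤ 1 := by nlinarith
  set w := (s : ℂ) * inner ℂ (orbit U y j) (orbit U z i) +
    (s : ℂ) * inner ℂ (orbit U z j) (orbit U y i) + inner ℂ (orbit U z j) (orbit U z i) with hw
  have h1 : A i j * inner ℂ (orbit U ((s : ℂ) • y + z) j) (orbit U ((s : ℂ) • y + z) i) =
      ((1 / 2 : ℝ) : ℂ) * (A i j * inner ℂ (orbit U y j) (orbit U y i)) + A i j * w := by
    simp only [orbit_add, orbit_smul, inner_add_left, inner_add_right, inner_smul_left,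
      inner_smul_right, Complex.conj_ofReal]
    rw [← hss, hw]
    push_cast
    ring
  have hsn : ‖(s : ℂ)‖ ≤ 1 := by simpa [abs_of_nonneg hs0] using hs1
  have h2 : ‖w‖ ≤ ‖inner ℂ (orbit U y j) (orbit U z i)‖ +
      ‖inner ℂ (orbit U y i) (orbit U z j)‖ + ‖inner ℂ (orbit U z j) (orbit U z i)‖ := by
    refine (norm_add_le _ _).trans (add_le_add_left ((norm_add_le _ _).trans ?_) _)
    rw [norm_mul, norm_mul, norm_inner_symm (orbit U z j) (orbit U y i)]
    exact add_le_add (mul_le_of_le_one_left (norm_nonneg _) hsn)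
      (mul_le_of_le_one_left (norm_nonneg _) hsn)
  have h3 : |(A i j * w).re| ≤ ‖A i j‖ * ‖w‖ := by
    rw [← norm_mul]; exact Complex.abs_re_le_norm _
  have h4 := mul_le_mul_of_nonneg_left h2 (norm_nonneg (A i j))
  rw [h1, Complex.add_re, Complex.re_ofReal_mul]
  linarith [(abs_le.1 h3).1]

lemma le_setIntegral_exp_gramForm (hn : 0 < n) {A : Matrix ι ι ℂ} (hA : ∀ i, A i i = 0)
    (U : UnitaryTuple ι n) {y : EuclideanSpace ℂ (Fin n)} (hy : ‖y‖ = 1) {ε : ℝ} (hε : 0 ≤ ε)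
    (hU : ∀ i j, i ≠ j → ∫ z in Metric.closedBall (0 : EuclideanSpace ℂ (Fin n)) √(1 / 2),
        ‖inner ℂ (orbit U z i) (orbit U z j)‖ ≤
      ε * volume.real (Metric.closedBall (0 : EuclideanSpace ℂ (Fin n)) √(1 / 2))) :
    Real.exp (n * gramForm A (orbit U y) / 2 -
        2 * n * (∑ i, ∑ j, ‖A i j‖) * (2 / √n + ε)) *
      ((1 / 2) ^ n * volume.real (Metric.closedBall (0 : EuclideanSpace ℂ (Fin n)) 1) / 2) ≤
    ∫ x in Metric.closedBall (0 : EuclideanSpace ℂ (Fin n)) 1,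
      Real.exp (n * gramForm A (orbit U x)) := by
  rw [← measureReal_closedBall_sqrt_half]
  set s : ℝ := √(1 / 2) with hs
  have hs0 : 0 ≤ s := Real.sqrt_nonneg _
  have hss : s ^ 2 = 1 / 2 := Real.sq_sqrt (by norm_num)
  have hs1 : s ≤ 1 := by nlinarith
  set T := Metric.closedBall (0 : EuclideanSpace ℂ (Fin n)) s with hT
  set S := T ∩ {z | (inner ℂ y z).re ≤ 0} with hS
  have hTS : volume.real T ≤ 2 * volume.real S := measureReal_closedBall_le_two_mul y s
  have hTc : IsCompact T := isCompact_closedBall _ _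
  have hSc : IsCompact S := hTc.inter_right
    (isClosed_le (by fun_prop) continuous_const)
  have hint {K : Set (EuclideanSpace ℂ (Fin n))} (hK : IsCompact K)
      {f : EuclideanSpace ℂ (Fin n) → ℝ} (hf : Continuous f) : IntegrableOn f K :=
    hf.continuousOn.integrableOn_compact hK
  have ho (i : ι) : Continuous fun z => orbit U z i := continuous_orbit continuous_const
    continuous_id i
  set Q : EuclideanSpace ℂ (Fin n) → ℝ := fun z =>
    ∑ i, ∑ j, ‖A i j‖ * (‖inner ℂ (orbit U y j) (orbit U z i)‖ +
      ‖inner ℂ (orbit U y i) (orbit U z j)‖ + ‖inner ℂ (orbit U z j) (orbit U z i)‖) with hQ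
  have hQc : Continuous Q := by fun_prop
  have hQ0 (z) : 0 ≤ Q z :=
    Finset.sum_nonneg fun i _ => Finset.sum_nonneg fun j _ => by positivity
  have hQT : ∫ z in T, Q z ≤ (∑ i, ∑ j, ‖A i j‖) * (2 / √n + ε) * volume.real T := by
    rw [hQ, integral_finsetSum _ fun i _ => hint hTc (by fun_prop), Finset.sum_mul, Finset.sum_mul]
    refine Finset.sum_le_sum fun i _ => ?_
    rw [integral_finsetSum _ fun j _ => hint hTc (by fun_prop), Finset.sum_mul, Finset.sum_mul]
    refine Finset.sum_le_sum fun j _ => ?_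
    rw [integral_const_mul, mul_assoc]
    by_cases hij : i = j
    · simp [hij, hA]
    refine mul_le_mul_of_nonneg_left ?_ (norm_nonneg _)
    rw [integral_add (hint hTc (by fun_prop)) (hint hTc (by fun_prop)),
      integral_add (hint hTc (by fun_prop)) (hint hTc (by fun_prop))]
    have h1 := setIntegral_norm_inner_orbit_le hn hs1 U hy.le j i
    have h2 := setIntegral_norm_inner_orbit_le hn hs1 U hy.le i j
    have h3 := hU j i (Ne.symm hij)
    calc _ ≤ volume.real T / √n + volume.real T / √n + ε * volume.real T :=
          add_le_add (add_le_add h1 h2) h3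
      _ = _ := by ring
  have hQS : ∫ z in S, n * Q z ≤
      (2 * n * (∑ i, ∑ j, ‖A i j‖) * (2 / √n + ε)) * volume.real S := by
    rw [integral_const_mul]
    have h1 : ∫ z in S, Q z ≤ ∫ z in T, Q z := setIntegral_mono_set (hint hTc hQc)
      (Filter.Eventually.of_forall hQ0) (Filter.Eventually.of_forall Set.inter_subset_left)
    have hK : 0 ≤ (∑ i, ∑ j, ‖A i j‖) * (2 / √n + ε) := by positivity
    calc n * ∫ z in S, Q z ≤ n * ((∑ i, ∑ j, ‖A i j‖) * (2 / √n + ε) * (2 * volume.real S)) :=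
          mul_le_mul_of_nonneg_left (h1.trans (hQT.trans (mul_le_mul_of_nonneg_left hTS hK)))
            (Nat.cast_nonneg n)
      _ = _ := by ring
  have hJ := exp_neg_mul_integral_le (μ := volume.restrict S) (w := fun _ => 1)
    (R := fun z => n * Q z) (c := 2 * n * (∑ i, ∑ j, ‖A i j‖) * (2 / √n + ε))
    (fun _ => zero_le_one) (hint hSc continuous_const) (hint hSc (by fun_prop))
    (hint hSc (by fun_prop)) (by simpa using hQS)
  simp only [one_mul, integral_const, smul_eq_mul, mul_one] at hJ
  rw [measureReal_restrict_apply_univ] at hJ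
  set f : EuclideanSpace ℂ (Fin n) → ℝ := fun x => Real.exp (n * gramForm A (orbit U x)) with hf
  have hfc : Continuous f := by
    have := continuous_gramForm_orbit (continuous_const (y := U))
      (continuous_id (X := EuclideanSpace ℂ (Fin n))) A
    simp only [id] at this
    fun_prop
  set p : EuclideanSpace ℂ (Fin n) := ((s : ℝ) : ℂ) • y with hp
  have htrans : ∫ z in S, f (p + z) ≤ ∫ x in Metric.closedBall 0 1, f x := by
    have hmp := measurePreserving_add_left (volume : Measure (EuclideanSpace ℂ (Fin n))) p
    have hpre := hmp.setIntegral_preimage_emb (Homeomorph.addLeft p).measurableEmbedding f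
      (Metric.closedBall 0 1)
    rw [← hpre]
    refine setIntegral_mono_set ?_ (Filter.Eventually.of_forall fun z => (Real.exp_pos _).le)
      (Filter.Eventually.of_forall ?_)
    · refine hint ?_ (hfc.comp (continuous_const_add p))
      exact (Homeomorph.addLeft p).isCompact_preimage.2 (isCompact_closedBall _ _)
    · intro z hz
      refine mem_closedBall_zero_iff.2 ?_
      refine (sq_le_one_iff₀ (norm_nonneg _)).1 ?_
      have hz1 : ‖z‖ ^ 2 ≤ 1 / 2 := by
        rw [← hss]
        exact pow_le_pow_left₀ (norm_nonneg _) (mem_closedBall_zero_iff.1 hz.1) 2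
      have hz2 : (inner ℂ y z).re ≤ 0 := hz.2
      rw [norm_add_sq (𝕜 := ℂ), hp, inner_smul_left, norm_smul, hy, Complex.conj_ofReal]
      simp only [RCLike.re_to_complex, Complex.re_ofReal_mul, mul_one, Complex.norm_real,
        Real.norm_eq_abs, sq_abs, hss]
      nlinarith [mul_nonpos_of_nonneg_of_nonpos hs0 hz2]
  have hpt (z) : Real.exp (n * gramForm A (orbit U y) / 2) * Real.exp (-(n * Q z)) ≤ f (p + z) := by
    rw [← Real.exp_add]
    refine Real.exp_le_exp.2 ?_
    have := mul_le_mul_of_nonneg_left (le_gramForm_orbit_add A U y z) (Nat.cast_nonneg (α := ℝ) n)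
    refine le_trans (le_of_eq ?_) this
    ring
  refine le_trans ?_ ((setIntegral_mono_on (hint hSc (by fun_prop))
    (hint hSc (by fun_prop)) hSc.measurableSet fun z _ => hpt z).trans htrans)
  rw [integral_const_mul, sub_eq_add_neg, Real.exp_add, mul_assoc]
  refine mul_le_mul_of_nonneg_left (le_trans ?_ hJ) (Real.exp_pos _).le
  exact mul_le_mul_of_nonneg_left (by linarith) (Real.exp_pos _).le

end UnitaryTuple

lemma tendsto_exp_sqrt_sub (a : ℝ) {b : ℝ} (hb : 0 < b) :
    Filter.Tendsto (fun n : ℕ => Real.exp (a * √n - b * n)) Filter.atTop (nhds 0) := by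
  refine Real.tendsto_exp_atBot.comp ?_
  have hs : Filter.Tendsto (fun n : ℕ => √(n : ℝ)) Filter.atTop Filter.atTop :=
    Real.tendsto_sqrt_atTop.comp tendsto_natCast_atTop_atTop
  have h2 : Filter.Tendsto (fun n : ℕ => a - b * √(n : ℝ)) Filter.atTop Filter.atBot := by
    have := Filter.tendsto_atBot_add_const_left _ a
      (Filter.tendsto_neg_atTop_atBot.comp (hs.const_mul_atTop hb))
    simpa [sub_eq_add_neg, Function.comp_def] using this
  refine (hs.atTop_mul_atBot₀ h2).congr fun n => ?_
  have := Real.mul_self_sqrt (Nat.cast_nonneg (α := ℝ) n)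
  linear_combination (-b) * this

lemma Matrix.PosSemidef.det_re_le_exp {ι : Type*} [Fintype ι] [DecidableEq ι] {P : Matrix ι ι ℂ}
    (hP : P.PosSemidef) : P.det.re ≤ Real.exp (P.trace.re - Fintype.card ι) := by
  have h1 : P.det.re = ∏ i, hP.isHermitian.eigenvalues i := by
    rw [hP.isHermitian.det_eq_prod_eigenvalues]
    simp only [Complex.coe_algebraMap]
    rw [← Complex.ofReal_prod, Complex.ofReal_re]
  have h2 : P.trace.re = ∑ i, hP.isHermitian.eigenvalues i := by
    rw [hP.isHermitian.trace_eq_sum_eigenvalues]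
    simp
  rw [h1, h2, show (∑ i, hP.isHermitian.eigenvalues i) - (Fintype.card ι : ℝ) =
    ∑ i, (hP.isHermitian.eigenvalues i - 1) by simp, Real.exp_sum]
  refine Finset.prod_le_prod (fun i _ => hP.eigenvalues_nonneg i) fun i _ => ?_
  linarith [Real.add_one_le_exp (hP.isHermitian.eigenvalues i - 1)]

namespace UnitaryTuple
variable {ι : Type*} [Fintype ι] {n : ℕ}

lemma integral_setIntegral_swap {f : UnitaryTuple ι n → EuclideanSpace ℂ (Fin n) → ℝ}
    (hf : Continuous fun p : UnitaryTuple ι n × EuclideanSpace ℂ (Fin n) => f p.1 p.2)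
    {K : Set (EuclideanSpace ℂ (Fin n))} (hK : IsCompact K) :
    Integrable (fun U => ∫ z in K, f U z) (haar ι n) ∧
    ∫ U, (∫ z in K, f U z) ∂haar ι n = ∫ z in K, (∫ U, f U z ∂haar ι n) ∧
    IntegrableOn (fun z => ∫ U, f U z ∂haar ι n) K := by
  have hint : Integrable (Function.uncurry f) ((haar ι n).prod (volume.restrict K)) := by
    have h := (hf.continuousOn (s := Set.univ ×ˢ K)).integrableOn_compact
      (μ := (haar ι n).prod volume) (isCompact_univ.prod hK)
    rw [IntegrableOn, ← Measure.prod_restrict, Measure.restrict_univ] at h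
    exact h
  exact ⟨hint.integral_prod_left, integral_integral_swap hint, hint.integral_prod_right⟩

lemma measureReal_overlap_le (hn : 0 < n) {i j : ι} (hij : i ≠ j) {ρ ε : ℝ} (hρ0 : 0 < ρ)
    (hρ : ρ ≤ 1) (hε : 0 < ε) :
    (haar ι n).real {U | ε * volume.real (Metric.closedBall (0 : EuclideanSpace ℂ (Fin n)) ρ) ≤
      ∫ z in Metric.closedBall (0 : EuclideanSpace ℂ (Fin n)) ρ,
        ‖inner ℂ (orbit U z i) (orbit U z j)‖} ≤ 1 / (ε * √n) := by
  have hs : 0 < √(n : ℝ) := Real.sqrt_pos.2 (by exact_mod_cast hn)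
  set T := Metric.closedBall (0 : EuclideanSpace ℂ (Fin n)) ρ with hT
  have hTc : IsCompact T := isCompact_closedBall _ _
  have hv : 0 < volume.real T := ENNReal.toReal_pos
    (Metric.measure_closedBall_pos volume _ hρ0).ne' hTc.measure_lt_top.ne
  have hc : Continuous fun p : UnitaryTuple ι n × EuclideanSpace ℂ (Fin n) =>
      ‖inner ℂ (orbit p.1 p.2 i) (orbit p.1 p.2 j)‖ :=
    ((continuous_orbit_apply i).inner (continuous_orbit_apply j)).norm
  obtain ⟨h1, h2, h3⟩ := integral_setIntegral_swap
    (f := fun U z => ‖inner ℂ (orbit U z i) (orbit U z j)‖) hc hTc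
  have hM := mul_meas_ge_le_integral_of_nonneg (μ := haar ι n)
    (Filter.Eventually.of_forall fun U => integral_nonneg fun z => norm_nonneg _) h1
    (ε * volume.real T)
  have hb : ∫ z in T, (∫ U, ‖inner ℂ (orbit U z i) (orbit U z j)‖ ∂haar ι n) ≤
      volume.real T / √n := by
    calc _ ≤ ∫ z in T, 1 / √(n : ℝ) := setIntegral_mono_on h3
            (continuousOn_const.integrableOn_compact hTc) hTc.measurableSet fun z hz => by
            have := (mem_closedBall_zero_iff.1 hz).trans hρ
            exact integral_sq_norm_inner_orbit_le hn hij this this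
      _ = _ := by simp [div_eq_mul_inv]
  rw [h2] at hM
  have h4 := hM.trans hb
  rw [le_div_iff₀ (by positivity)]
  rw [le_div_iff₀ hs] at h4
  refine le_of_mul_le_mul_left ?_ hv
  linarith

variable [DecidableEq ι]

lemma gramForm_offDiag (P : Matrix ι ι ℂ) (U : UnitaryTuple ι n)
    (x : EuclideanSpace ℂ (Fin n)) :
    gramForm (diagonal P.diag - P) (orbit U x) =
      gramForm (1 - P) (orbit U x) - ‖x‖ ^ 2 * (Fintype.card ι - P.trace.re) := by
  have h : diagonal P.diag - P = (1 - P) - (1 - diagonal P.diag) := by abel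
  have h2 : gramForm (1 - diagonal P.diag) (orbit U x) =
      ‖x‖ ^ 2 * (Fintype.card ι - P.trace.re) := by
    rw [gramForm_one_sub, gramForm]
    simp only [trace, diag_apply, diagonal_mul, gram_apply, Complex.re_sum, norm_orbit]
    have (i : ι) : (P i i * inner ℂ (orbit U x i) (orbit U x i)).re = ‖x‖ ^ 2 * (P i i).re := by
      rw [inner_self_eq_norm_sq_to_K, norm_orbit, mul_comm]
      norm_cast
      exact Complex.re_ofReal_mul _ _
    simp only [this, ← Finset.mul_sum]
    simp
    ring
  rw [← h2]
  simp only [gramForm, h, Matrix.sub_mul, trace_sub, Complex.sub_re]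

/-- Tuples for which all pairs of orbit components are nearly orthogonal on average over a ball. -/
def almostOrthogonal (ι : Type*) (n : ℕ) (ε : ℝ) : Set (UnitaryTuple ι n) :=
  {U | ∀ i j, i ≠ j → ∫ z in Metric.closedBall (0 : EuclideanSpace ℂ (Fin n)) √(1 / 2),
        ‖inner ℂ (orbit U z i) (orbit U z j)‖ ≤
      ε * volume.real (Metric.closedBall (0 : EuclideanSpace ℂ (Fin n)) √(1 / 2))}

omit [DecidableEq ι] in
lemma measureReal_compl_almostOrthogonal_le (hn : 0 < n) {ε : ℝ} (hε : 0 < ε) :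
    (haar ι n).real (almostOrthogonal ι n ε)ᶜ ≤ Fintype.card ι ^ 2 * (1 / (ε * √n)) := by
  have hs : √(1 / 2 : ℝ) ≤ 1 := Real.sqrt_le_one.2 (by norm_num)
  have hs0 : 0 < √(1 / 2 : ℝ) := Real.sqrt_pos.2 (by norm_num)
  classical
  have hsub : (almostOrthogonal ι n ε)ᶜ ⊆
      ⋃ p ∈ (Finset.univ : Finset (ι × ι)).filter fun p => p.1 ≠ p.2, {U | ε * volume.real
        (Metric.closedBall (0 : EuclideanSpace ℂ (Fin n)) √(1 / 2)) ≤
          ∫ z in Metric.closedBall (0 : EuclideanSpace ℂ (Fin n)) √(1 / 2),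
        ‖inner ℂ (orbit U z p.1) (orbit U z p.2)‖} := by
    intro U hU
    simp only [almostOrthogonal, Set.mem_compl_iff, Set.mem_ofPred_eq, not_forall, not_le] at hU
    obtain ⟨i, j, hij, h⟩ := hU
    simp only [Set.mem_iUnion]
    exact ⟨(i, j), by simpa using hij, h.le⟩
  refine (measureReal_mono hsub (measure_ne_top _ _)).trans ((measureReal_biUnion_finset_le _ _).trans ?_)
  calc _ ≤ ∑ p ∈ (Finset.univ : Finset (ι × ι)).filter fun p => p.1 ≠ p.2, 1 / (ε * √n) :=
        Finset.sum_le_sum fun p hp =>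
          measureReal_overlap_le hn (Finset.mem_filter.1 hp).2 hs0 hs hε
    _ ≤ ∑ p : ι × ι, 1 / (ε * √n) :=
        Finset.sum_le_sum_of_subset_of_nonneg (Finset.filter_subset _ _) fun _ _ _ => by positivity
    _ = _ := by
        rw [Finset.sum_const, Finset.card_univ, Fintype.card_prod, nsmul_eq_mul]
        push_cast; ring

lemma integral_exp_gramForm_offDiag_le {P : Matrix ι ι ℂ} (hP : P.PosDef) (hn : 25 ≤ n)
    {x : EuclideanSpace ℂ (Fin n)} (hx : ‖x‖ ≤ 1) :
    ∫ U, Real.exp (n * gramForm (diagonal P.diag - P) (orbit U x)) ∂haar ι n ≤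
      1 + Real.exp (4 * Real.exp 2 * (∑ i, ∑ j, ‖(1 - P) i j‖) * √n) *
        (Real.exp (P.trace.re - Fintype.card ι) / P.det.re) ^ n := by
  have hdet : 0 < P.det.re := (Complex.lt_def.1 hP.det_pos).1
  obtain ⟨e, he, hxe⟩ : ∃ e : EuclideanSpace ℂ (Fin n), ‖e‖ = 1 ∧ x = ((‖x‖ : ℝ) : ℂ) • e := by
    by_cases h : x = 0
    · refine ⟨EuclideanSpace.single ⟨0, by omega⟩ 1, by simp, by simp [h]⟩
    · have h' := norm_ne_zero_iff.2 h
      refine ⟨((‖x‖⁻¹ : ℝ) : ℂ) • x, by simp [norm_smul, h'], ?_⟩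
      rw [smul_smul, ← Complex.ofReal_mul, mul_inv_cancel₀ h']; simp
  have hc (B : Matrix ι ι ℂ) (v : EuclideanSpace ℂ (Fin n)) :
      Continuous fun U : UnitaryTuple ι n => Real.exp (n * gramForm B (orbit U v)) := by
    have := continuous_gramForm_orbit (continuous_id (X := UnitaryTuple ι n))
      (continuous_const (y := v)) B
    simp only [id] at this
    fun_prop
  have hpt (U : UnitaryTuple ι n) :
      Real.exp (n * gramForm (diagonal P.diag - P) (orbit U x)) ≤
      1 + Real.exp (P.trace.re - Fintype.card ι) ^ n *
        Real.exp (n * gramForm (1 - P) (orbit U e)) := by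
    set A := diagonal P.diag - P
    have h1 : gramForm A (orbit U x) = ‖x‖ ^ 2 * gramForm A (orbit U e) := by
      rw [gramForm_eq_sum, gramForm_eq_sum, Finset.mul_sum]
      refine Finset.sum_congr rfl fun i _ => ?_
      rw [Finset.mul_sum]
      refine Finset.sum_congr rfl fun j _ => ?_
      conv_lhs => rw [hxe]
      rw [orbit_smul, orbit_smul, inner_smul_left, inner_smul_right, Complex.conj_ofReal,
        ← Complex.re_ofReal_mul]
      congr 1
      push_cast
      ring
    have h2 : Real.exp (P.trace.re - Fintype.card ι) ^ n *
        Real.exp (n * gramForm (1 - P) (orbit U e)) = Real.exp (n * gramForm A (orbit U e)) := by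
      rw [← Real.exp_nat_mul, ← Real.exp_add, gramForm_offDiag, he]
      congr 1; ring
    rw [h2, h1]
    have ht : ‖x‖ ^ 2 ≤ 1 := pow_le_one₀ (norm_nonneg _) hx
    rcases le_total 0 (n * gramForm A (orbit U e)) with h | h
    · have : n * (‖x‖ ^ 2 * gramForm A (orbit U e)) ≤ n * gramForm A (orbit U e) := by
        nlinarith
      linarith [Real.exp_le_exp.2 this]
    · have : n * (‖x‖ ^ 2 * gramForm A (orbit U e)) ≤ 0 := by
        nlinarith [sq_nonneg ‖x‖]
      linarith [Real.exp_le_one_iff.2 this, Real.exp_pos (n * gramForm A (orbit U e))]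
  have hB : (1 - (1 - P)).PosDef := by rwa [sub_sub_cancel]
  have hmain := integral_exp_gramForm_orbit_le hB hn he
  rw [sub_sub_cancel] at hmain
  calc _ ≤ ∫ U, (1 + Real.exp (P.trace.re - Fintype.card ι) ^ n *
        Real.exp (n * gramForm (1 - P) (orbit U e))) ∂haar ι n :=
        integral_mono (integrable_haar (hc _ _)) ((integrable_const _).add
          ((integrable_haar (hc _ _)).const_mul _)) hpt
    _ = 1 + Real.exp (P.trace.re - Fintype.card ι) ^ n *
        ∫ U, Real.exp (n * gramForm (1 - P) (orbit U e)) ∂haar ι n := by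
        rw [integral_add (integrable_const _) ((integrable_haar (hc _ _)).const_mul _),
          integral_const_mul]
        simp
    _ ≤ 1 + Real.exp (P.trace.re - Fintype.card ι) ^ n *
        (Real.exp (4 * Real.exp 2 * (∑ i, ∑ j, ‖(1 - P) i j‖) * √n) / P.det.re ^ n) := by
        gcongr
    _ = _ := by rw [div_pow]; ring

end UnitaryTuple

namespace UnitaryTuple
variable {ι : Type*} [Fintype ι] [DecidableEq ι]

lemma measureReal_exists_lt_gramForm_le {P : Matrix ι ι ℂ} (hP : P.PosDef) {n : ℕ} (hn : 25 ≤ n)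
    {S C L ε : ℝ} (hS : ∑ i, ∑ j, ‖(diagonal P.diag - P) i j‖ = S)
    (hC : 4 * Real.exp 2 * (∑ i, ∑ j, ‖(1 - P) i j‖) = C)
    (hL : Real.log P.det.re - Real.log 2 = L) (hε : 0 < ε) (hSε : 2 * S * ε ≤ L / 4) :
    (haar ι n).real {U | ∃ y, ‖y‖ = 1 ∧ 2 * (P.trace.re - Fintype.card ι) - L / 2 <
      gramForm (diagonal P.diag - P) (orbit U y)} ≤
      Fintype.card ι ^ 2 * (1 / (ε * √n)) + 4 * Real.exp ((4 * S + C) * √n - L / 2 * n) := by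
  have hn0 : 0 < n := by omega
  have hnR : (0 : ℝ) < n := by exact_mod_cast hn0
  have hdet : 0 < P.det.re := (Complex.lt_def.1 hP.det_pos).1
  have hC0 : 0 ≤ C := by rw [← hC]; positivity
  set A := diagonal P.diag - P with hA
  set b := P.trace.re - Fintype.card ι with hb
  have hbl : Real.log P.det.re ≤ b :=
    (Real.log_le_iff_le_exp hdet).2 hP.posSemidef.det_re_le_exp
  set K := Metric.closedBall (0 : EuclideanSpace ℂ (Fin n)) 1 with hK
  have hKc : IsCompact K := isCompact_closedBall _ _
  set V := volume.real K with hV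
  have hV0 : 0 < V := ENNReal.toReal_pos
    (Metric.measure_closedBall_pos volume _ one_pos).ne' hKc.measure_lt_top.ne
  set t := Real.exp (n * (b - L / 4) - 2 * n * S * (2 / √n + ε)) * ((1 / 2) ^ n * V / 2) with ht
  have ht0 : 0 < t := by positivity
  have hcont : Continuous fun p : UnitaryTuple ι n × EuclideanSpace ℂ (Fin n) =>
      Real.exp (n * gramForm A (orbit p.1 p.2)) := by
    have := continuous_gramForm_orbit
      (continuous_fst (X := UnitaryTuple ι n) (Y := EuclideanSpace ℂ (Fin n))) continuous_snd A
    fun_prop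
  obtain ⟨h1, h2, h3⟩ := integral_setIntegral_swap
    (f := fun U x => Real.exp (n * gramForm A (orbit U x))) hcont hKc
  have hM := mul_meas_ge_le_integral_of_nonneg (μ := haar ι n)
    (Filter.Eventually.of_forall fun U => integral_nonneg fun z => (Real.exp_pos _).le) h1 t
  rw [h2] at hM
  have hsqrt : (n : ℝ) * (2 / √n) = 2 * √n := by
    have := Real.mul_self_sqrt hnR.le
    have h0 : 0 < √(n : ℝ) := Real.sqrt_pos.2 hnR
    field_simp
    nlinarith
  set R := 1 + Real.exp (C * √n) * (Real.exp b / P.det.re) ^ n with hR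
  have hint : ∫ x in K, (∫ U, Real.exp (n * gramForm A (orbit U x)) ∂haar ι n) ≤ V * R := by
    calc _ ≤ ∫ x in K, R := setIntegral_mono_on h3
            (continuousOn_const.integrableOn_compact hKc) hKc.measurableSet fun z hz => by
            have := integral_exp_gramForm_offDiag_le hP hn (mem_closedBall_zero_iff.1 hz)
            rwa [hC] at this
      _ = _ := by simp [V]
  have hVR : V * R ≤ t * (4 * Real.exp ((4 * S + C) * √n - L / 2 * n)) := by
    have e1 : R = 1 + Real.exp (C * √n + n * (b - Real.log P.det.re)) := by
      rw [hR, Real.exp_add, Real.exp_nat_mul, Real.exp_sub b, Real.exp_log hdet]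
    have e2 : t * (4 * Real.exp ((4 * S + C) * √n - L / 2 * n)) = V * (2 * Real.exp
        (C * √n + n * (b - L / 4 - 2 * S * ε - L / 2 - Real.log 2))) := by
      have : ((1 : ℝ) / 2) ^ n = Real.exp (n * (- Real.log 2)) := by
        rw [Real.exp_nat_mul, Real.exp_neg, Real.exp_log two_pos, one_div]
      rw [ht, this]
      have e3 : Real.exp (C * √n + n * (b - L / 4 - 2 * S * ε - L / 2 - Real.log 2)) =
          Real.exp (n * (b - L / 4) - 2 * n * S * (2 / √n + ε)) * Real.exp (n * (- Real.log 2)) *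
          Real.exp ((4 * S + C) * √n - L / 2 * n) := by
        rw [← Real.exp_add, ← Real.exp_add]
        congr 1
        linear_combination (2 * S) * hsqrt
      rw [e3]; ring
    rw [e1, e2]
    refine mul_le_mul_of_nonneg_left ?_ hV0.le
    have i1 : 1 ≤ Real.exp (C * √n + n * (b - L / 4 - 2 * S * ε - L / 2 - Real.log 2)) := by
      refine Real.one_le_exp (add_nonneg (by positivity) (mul_nonneg hnR.le ?_))
      linarith
    have i2 : Real.exp (C * √n + n * (b - Real.log P.det.re)) ≤
        Real.exp (C * √n + n * (b - L / 4 - 2 * S * ε - L / 2 - Real.log 2)) := by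
      refine Real.exp_le_exp.2 (add_le_add_right (mul_le_mul_of_nonneg_left ?_ hnR.le) _)
      linarith
    linarith
  have hsub : {U : UnitaryTuple ι n | ∃ y, ‖y‖ = 1 ∧ 2 * b - L / 2 < gramForm A (orbit U y)} ⊆
      (almostOrthogonal ι n ε)ᶜ ∪
        {U | t ≤ ∫ x in K, Real.exp (n * gramForm A (orbit U x))} := by
    rintro U ⟨y, hy, hlt⟩
    by_cases hU : U ∈ almostOrthogonal ι n ε
    · right
      refine le_trans ?_ (le_setIntegral_exp_gramForm hn0 (A := A) (fun i => by simp [hA]) U hy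
        hε.le hU)
      rw [hS]
      refine mul_le_mul_of_nonneg_right (Real.exp_le_exp.2 ?_) (by positivity)
      nlinarith
    · exact Or.inl hU
  refine (measureReal_mono hsub (measure_ne_top _ _)).trans ((measureReal_union_le _ _).trans
    (add_le_add (measureReal_compl_almostOrthogonal_le hn0 hε) ?_))
  exact le_of_mul_le_mul_left (hM.trans (hint.trans hVR)) ht0

/-- With high probability no orbit has a Gram matrix lying in a half space beyond the tangent
hyperplane attached to a positive definite matrix of determinant exceeding `2`. -/
lemma exists_tendsto_measureReal_exists_lt_gramForm {P : Matrix ι ι ℂ} (hP : P.PosDef)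
    (hdet : 2 < P.det.re) : ∃ η > 0, Filter.Tendsto (fun n : ℕ => (haar ι n).real
      {U | ∃ y, ‖y‖ = 1 ∧ 2 * (P.trace.re - Fintype.card ι) - η <
        gramForm (diagonal P.diag - P) (orbit U y)}) Filter.atTop (nhds 0) := by
  obtain ⟨L, hL⟩ : ∃ L, Real.log P.det.re - Real.log 2 = L := ⟨_, rfl⟩
  have hL0 : 0 < L := by rw [← hL]; exact sub_pos.2 (Real.log_lt_log two_pos hdet)
  obtain ⟨S, hS⟩ : ∃ S, ∑ i, ∑ j, ‖(diagonal P.diag - P) i j‖ = S := ⟨_, rfl⟩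
  have hS0 : 0 ≤ S := by rw [← hS]; positivity
  have hε : 0 < L / (8 * (S + 1)) := by positivity
  refine ⟨L / 2, half_pos hL0, squeeze_zero' (Filter.Eventually.of_forall fun n =>
    measureReal_nonneg) (Filter.eventually_atTop.2 ⟨25, fun n hn =>
      measureReal_exists_lt_gramForm_le hP hn hS rfl hL hε ?_⟩) ?_⟩
  · have : 2 * S * (L / (8 * (S + 1))) = L / 4 * (S / (S + 1)) := by field_simp; ring
    rw [this]
    exact mul_le_of_le_one_right (by positivity) ((div_le_one (by positivity)).2 (by linarith))
  · have hs : Filter.Tendsto (fun n : ℕ => √(n : ℝ)) Filter.atTop Filter.atTop :=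
      Real.tendsto_sqrt_atTop.comp tendsto_natCast_atTop_atTop
    have t1 := ((hs.const_mul_atTop hε).inv_tendsto_atTop).const_mul
      ((Fintype.card ι : ℝ) ^ 2)
    have t2 := (tendsto_exp_sqrt_sub (4 * S + 4 * Real.exp 2 * ∑ i, ∑ j, ‖(1 - P) i j‖)
      (half_pos hL0)).const_mul 4
    have := t1.add t2
    simpa [one_div] using this

end UnitaryTuple

section
variable {ι : Type*} [Fintype ι] [DecidableEq ι]

/-- Correlation matrices `G` for which the determinant of `(1 + G) / 2` is at most `c`. -/
def smallDetGram (ι : Type*) [Fintype ι] [DecidableEq ι] (c : ℝ) : Set (Matrix ι ι ℂ) :=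
  {G | (∀ i j, ‖G i j‖ ≤ 1) ∧ G.PosSemidef ∧ (∀ i, G i i = 1) ∧
    ((1 / 2 : ℂ) • (1 + G)).det.re ≤ c}

omit [DecidableEq ι] in
lemma isClosed_posSemidef : IsClosed {G : Matrix ι ι ℂ | G.PosSemidef} := by
  simp only [posSemidef_iff_dotProduct_mulVec, Set.ofPred_and, Set.ofPred_forall]
  refine IsClosed.inter (isClosed_eq continuous_id.matrix_conjTranspose continuous_id)
    (isClosed_iInter fun x => ?_)
  exact isClosed_le continuous_const
    (continuous_const.dotProduct (continuous_id.matrix_mulVec continuous_const))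

lemma isCompact_smallDetGram (c : ℝ) : IsCompact (smallDetGram ι c) := by
  have h : IsCompact (Set.univ.pi fun _ : ι => Set.univ.pi fun _ : ι =>
      Metric.closedBall (0 : ℂ) 1) :=
    isCompact_univ_pi fun _ => isCompact_univ_pi fun _ => isCompact_closedBall _ _
  refine IsCompact.of_isClosed_subset h ?_ ?_
  · have hentry (i j : ι) : Continuous fun G : Matrix ι ι ℂ => G i j :=
      continuous_id.matrix_elem i j
    simp only [smallDetGram, Set.ofPred_and, Set.ofPred_forall]
    refine IsClosed.inter (isClosed_iInter fun i => isClosed_iInter fun j =>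
      isClosed_le (hentry i j).norm continuous_const) (isClosed_posSemidef.inter
      (IsClosed.inter (isClosed_iInter fun i => isClosed_eq (hentry i i) continuous_const) ?_))
    refine isClosed_le (Complex.continuous_re.comp (Continuous.matrix_det ?_)) continuous_const
    exact Continuous.const_smul (continuous_const.add (continuous_id (X := Matrix ι ι ℂ))) (1 / 2 : ℂ)
  · intro G hG i _ j _
    simpa using hG.1 i j

lemma exists_posDef_of_mem_smallDetGram {c : ℝ} (hc : c < 1 / 2) {G : Matrix ι ι ℂ}
    (hG : G ∈ smallDetGram ι c) : ∃ P : Matrix ι ι ℂ, P.PosDef ∧ 2 < P.det.re ∧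
      ((diagonal P.diag - P) * G).trace.re = 2 * (P.trace.re - Fintype.card ι) := by
  obtain ⟨-, hpos, hdiag, hdet⟩ := hG
  set H := (1 / 2 : ℂ) • (1 + G) with hH
  have hHp : H.PosDef := (PosDef.one.add_posSemidef hpos).smul (by norm_num)
  have hdp := Complex.lt_def.1 hHp.det_pos
  have hunit : IsUnit H.det := isUnit_iff_ne_zero.2 hHp.det_pos.ne'
  refine ⟨H⁻¹, hHp.inv, ?_, ?_⟩
  · have : H.det = (H.det.re : ℂ) := Complex.ext rfl (by simpa using hdp.2.symm)
    rw [det_nonsing_inv, Ring.inverse_eq_inv', this, ← Complex.ofReal_inv, Complex.ofReal_re]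
    have h0 : 0 < H.det.re := hdp.1
    rw [lt_inv_comm₀ two_pos h0]
    linarith
  · have hG2 : G = (2 : ℂ) • H - 1 := by rw [hH, smul_smul]; simp
    have h1 : (diagonal (H⁻¹).diag * G).trace = (H⁻¹).trace := by
      simp [trace, diagonal_mul, hdiag]
    have h2 : (H⁻¹ * G).trace = 2 * Fintype.card ι - (H⁻¹).trace := by
      rw [hG2, Matrix.mul_sub, Matrix.mul_smul, nonsing_inv_mul _ hunit, trace_sub, trace_smul]
      simp
    rw [Matrix.sub_mul, trace_sub, h1, h2]
    simp; ring

end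

namespace UnitaryTuple
variable {ι : Type*} [Fintype ι] [DecidableEq ι]

lemma tendsto_measureReal_exists_gram_mem {c : ℝ} (hc : c < 1 / 2) :
    Filter.Tendsto (fun n : ℕ => (haar ι n).real
      {U | ∃ y, ‖y‖ = 1 ∧ gram ℂ (orbit U y) ∈ smallDetGram ι c}) Filter.atTop (nhds 0) := by
  refine (isCompact_smallDetGram c).induction_on (p := fun s => Filter.Tendsto
    (fun n : ℕ => (haar ι n).real {U | ∃ y, ‖y‖ = 1 ∧ gram ℂ (orbit U y) ∈ s})
    Filter.atTop (nhds 0)) ?_ ?_ ?_ ?_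
  · simp
  · intro s t hst ht
    refine squeeze_zero (fun _ => measureReal_nonneg) (fun n => measureReal_mono ?_
      (measure_ne_top _ _)) ht
    rintro U ⟨y, hy, h⟩
    exact ⟨y, hy, hst h⟩
  · intro s t hs ht
    have := hs.add ht
    rw [add_zero] at this
    refine squeeze_zero (fun _ => measureReal_nonneg) (fun n => (measureReal_mono ?_
      (measure_ne_top _ _)).trans (measureReal_union_le _ _)) this
    rintro U ⟨y, hy, h | h⟩
    · exact Or.inl ⟨y, hy, h⟩
    · exact Or.inr ⟨y, hy, h⟩
  · intro G hG
    obtain ⟨P, hP, hdet, htr⟩ := exists_posDef_of_mem_smallDetGram hc hG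
    obtain ⟨η, hη, hlim⟩ := exists_tendsto_measureReal_exists_lt_gramForm hP hdet
    refine ⟨{M | 2 * (P.trace.re - Fintype.card ι) - η < ((diagonal P.diag - P) * M).trace.re},
      mem_nhdsWithin_of_mem_nhds (IsOpen.mem_nhds (isOpen_lt continuous_const ?_) ?_), hlim⟩
    · exact Complex.continuous_re.comp (continuous_const.matrix_mul continuous_id).matrix_trace
    · simp only [Set.mem_ofPred_eq]
      linarith

/-- Some tuple of unitaries has all its orbits of unit vectors nearly orthonormal, in the sense
that the determinant of `(1 + G) / 2` stays close to `1 / 2` for their Gram matrices `G`. -/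
lemma exists_forall_lt_det {c : ℝ} (hc : c < 1 / 2) : ∃ n : ℕ, 0 < n ∧ ∃ U : UnitaryTuple ι n,
    ∀ y, ‖y‖ = 1 → c < ((1 / 2 : ℂ) • (1 + gram ℂ (orbit U y))).det.re := by
  obtain ⟨n, hn0, hn⟩ := ((Filter.eventually_gt_atTop 0).and
    ((tendsto_measureReal_exists_gram_mem (ι := ι) hc).eventually_lt_const one_pos)).exists
  refine ⟨n, hn0, ?_⟩
  by_contra! hcon
  have huniv : {U : UnitaryTuple ι n | ∃ y, ‖y‖ = 1 ∧
      gram ℂ (orbit U y) ∈ smallDetGram ι c} = Set.univ := by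
    refine Set.eq_univ_of_forall fun U => ?_
    obtain ⟨y, hy, h⟩ := hcon U
    refine ⟨y, hy, fun i j => ?_, posSemidef_gram ℂ _, fun i => ?_, h⟩
    · simpa [gram_apply, hy] using norm_inner_le_norm (𝕜 := ℂ) (orbit U y i) (orbit U y j)
    · rw [gram_apply, inner_self_eq_norm_sq_to_K, norm_orbit, hy]; simp
  rw [huniv] at hn
  simp at hn

end UnitaryTuple

lemma Real.log_le_sqrt_sub_inv {t : ℝ} (ht : 1 ≤ t) : Real.log t ≤ √t - (√t)⁻¹ := by
  have hs : 0 < √t := Real.sqrt_pos.2 (by linarith)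
  have h := Real.self_le_sinh_iff.2 (Real.log_nonneg (Real.one_le_sqrt.2 ht))
  rw [Real.sinh_log hs, Real.log_sqrt (by linarith)] at h
  linarith

/-- On `[1, 6.8]` the logarithm is dominated by a Möbius function. -/
lemma Real.log_le_three_mul_div {t : ℝ} (h1 : 1 ≤ t) (h2 : t ≤ 6.8) :
    Real.log t ≤ 3 * (t - 1) / (t + 1) := by
  have hs : 0 < √t := Real.sqrt_pos.2 (by linarith)
  have hsq : √t * √t = t := Real.mul_self_sqrt (by linarith)
  refine (Real.log_le_sqrt_sub_inv h1).trans ?_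
  have h3 : t + 1 ≤ 3 * √t := by
    refine le_of_sq_le_sq ?_ (by positivity)
    rw [mul_pow, sq √t, hsq]
    nlinarith
  have h4 : √t - (√t)⁻¹ = (t - 1) / √t := by
    rw [sub_div, one_div]
    congr 1
    rw [eq_div_iff hs.ne', hsq]
  rw [h4, div_le_div_iff₀ hs (by linarith)]
  nlinarith

/-- On `[0, 6.8]`, the relative entropy density `t log t - t + 1` is at most six times the
log-determinant density. -/
lemma Real.mul_log_sub_add_one_le {t : ℝ} (h0 : 0 ≤ t) (h1 : t ≤ 6.8) :
    t * Real.log t - t + 1 ≤ 6 * ((t - 1) / 2 - Real.log ((1 + t) / 2)) := by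
  have hl2 := Real.log_two_gt_d9
  rcases lt_or_ge t 0.2 with ht | ht
  · have e1 : Real.log ((1 + t) / 2) = Real.log (1 + t) - Real.log 2 :=
      Real.log_div (by linarith) two_ne_zero
    have e2 : Real.log (1 + t) ≤ t := by
      have := Real.log_le_sub_one_of_pos (x := 1 + t) (by linarith)
      linarith
    have e3 : t * Real.log t ≤ t * (7.4 * t - 3) := by
      rcases h0.eq_or_lt with rfl | h0
      · simp
      · refine mul_le_mul_of_nonneg_left ?_ h0.le
        have he : Real.exp 2 ≤ 7.4 := by
          have := Real.exp_one_lt_d9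
          have h2 : Real.exp 2 = Real.exp 1 * Real.exp 1 := by rw [← Real.exp_add]; norm_num
          rw [h2]
          nlinarith [Real.exp_pos 1]
        have := Real.log_le_sub_one_of_pos (x := Real.exp 2 * t) (by positivity)
        rw [Real.log_mul (Real.exp_pos 2).ne' h0.ne', Real.log_exp] at this
        nlinarith
    rw [e1]
    nlinarith
  set h : ℝ → ℝ := fun t =>
    6 * ((t - 1) / 2 - Real.log ((1 + t) / 2)) - (t * Real.log t - t + 1) with hh
  have hd (u : ℝ) (hu : 0 < u) : HasDerivAt h (3 * (u - 1) / (u + 1) - Real.log u) u := by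
    have d1 := (((((hasDerivAt_id u).sub_const 1).div_const 2).sub
      ((((hasDerivAt_id u).const_add 1).div_const 2).log (by simp; linarith))).const_mul 6).sub
      (((Real.hasDerivAt_mul_log hu.ne').sub (hasDerivAt_id u)).add_const 1)
    refine d1.congr_deriv ?_
    have : 1 + u ≠ 0 := by linarith
    have : u + 1 ≠ 0 := by linarith
    simp only [id]
    field_simp
    ring
  have hone : h 1 = 0 := by simp [hh]
  suffices 0 ≤ h t by simp only [hh] at this; linarith
  rcases le_total 1 t with ht1 | ht1
  · have hm : MonotoneOn h (Set.Icc 1 6.8) := by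
      refine monotoneOn_of_hasDerivWithinAt_nonneg (convex_Icc _ _)
        (fun u hu => (hd u (by linarith [hu.1])).continuousAt.continuousWithinAt)
        (fun u hu => (hd u ?_).hasDerivWithinAt) fun u hu => ?_
      · rw [interior_Icc] at hu; linarith [hu.1]
      · rw [interior_Icc] at hu
        exact sub_nonneg.2 (Real.log_le_three_mul_div hu.1.le hu.2.le)
    rw [← hone]
    exact hm ⟨le_rfl, by norm_num⟩ ⟨ht1, h1⟩ ht1
  · have hm : AntitoneOn h (Set.Icc 0.2 1) := by
      refine antitoneOn_of_hasDerivWithinAt_nonpos (convex_Icc _ _)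
        (fun u hu => (hd u (by linarith [hu.1])).continuousAt.continuousWithinAt)
        (fun u hu => (hd u ?_).hasDerivWithinAt) fun u hu => ?_
      · rw [interior_Icc] at hu; linarith [hu.1]
      · rw [interior_Icc] at hu
        have hu0 : 0 < u := by linarith [hu.1]
        have hi : 1 ≤ u⁻¹ := (one_le_inv₀ hu0).2 hu.2.le
        have hi2 : u⁻¹ ≤ 6.8 := by
          rw [inv_le_comm₀ hu0 (by norm_num)]
          refine le_trans ?_ hu.1.le
          norm_num
        have := Real.log_le_three_mul_div hi hi2
        rw [Real.log_inv] at this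
        have e : 3 * (u⁻¹ - 1) / (u⁻¹ + 1) = - (3 * (u - 1) / (u + 1)) := by
          have : u + 1 ≠ 0 := by linarith
          have : u⁻¹ + 1 ≠ 0 := by linarith
          have : 1 + u ≠ 0 := by linarith
          field_simp
          ring
        linarith
    rw [← hone]
    exact hm ⟨ht, ht1⟩ ⟨by norm_num, le_rfl⟩ ht1

/-- If `d` real numbers with mean one have `∏ (1 + τ) / 2` bounded below, then their relative
entropy to the uniform distribution is bounded. Zeros may be repeated freely. -/
lemma sum_mul_log_le_of_le_prod {κ : Type*} [Fintype κ] {τ : κ → ℝ} (h0 : ∀ l, 0 ≤ τ l) {d : ℕ}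
    (hsum : ∑ l, τ l = d) (hcard : ((Finset.univ.filter fun l => τ l ≠ 0).card) ≤ d)
    (hprod : 9 / 20 * 2 ^ d ≤ ∏ l, (1 + τ l)) :
    ∑ l, τ l * Real.log (τ l) ≤ 6 * Real.log (20 / 9) := by
  have hl2 := Real.log_two_gt_d9
  have hl2' := Real.log_two_lt_d9
  set J := Finset.univ.filter fun l => τ l ≠ 0 with hJ
  have hk : (J.card : ℝ) ≤ d := by exact_mod_cast hcard
  have hsumJ : ∑ l ∈ J, τ l = d := by
    rw [← hsum, hJ, Finset.sum_filter_ne_zero]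
  have hprodJ : ∏ l, (1 + τ l) = ∏ l ∈ J, (1 + τ l) := by
    refine (Finset.prod_subset (Finset.subset_univ J) fun l _ hl => ?_).symm
    simp only [hJ, Finset.mem_filter, Finset.mem_univ, true_and, not_not] at hl
    rw [hl, add_zero]
  have hpos (l : κ) : 0 < 1 + τ l := by linarith [h0 l]
  have hlog : Real.log (9 / 20) + d * Real.log 2 ≤ ∑ l ∈ J, Real.log (1 + τ l) := by
    rw [← Real.log_prod fun l _ => (hpos l).ne', ← Real.log_pow, ← Real.log_mul (by norm_num)
      (by positivity), ← hprodJ]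
    exact Real.log_le_log (by positivity) hprod
  have hinv : Real.log (9 / 20) = - Real.log (20 / 9) := by rw [← Real.log_inv]; norm_num
  have hg : ∑ l ∈ J, ((τ l - 1) / 2 - Real.log ((1 + τ l) / 2)) ≤
      (d - J.card) * (1 / 2 - Real.log 2) + Real.log (20 / 9) := by
    have e1 : ∑ l ∈ J, (τ l - 1) / 2 = (d - J.card) / 2 := by
      rw [← Finset.sum_div, Finset.sum_sub_distrib, hsumJ]; simp
    have e2 : ∑ l ∈ J, Real.log ((1 + τ l) / 2) =
        ∑ l ∈ J, Real.log (1 + τ l) - J.card * Real.log 2 := by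
      rw [Finset.sum_congr rfl fun l _ => Real.log_div (hpos l).ne' two_ne_zero]
      simp
    rw [Finset.sum_sub_distrib, e1, e2]
    linarith
  have hg0 (l : κ) : 0 ≤ (τ l - 1) / 2 - Real.log ((1 + τ l) / 2) := by
    have := Real.log_le_sub_one_of_pos (x := (1 + τ l) / 2) (by linarith [hpos l])
    linarith
  have hlt : Real.log (20 / 9) ≤ 11 / 10 := by
    have : Real.log (20 / 9) = Real.log 2 + Real.log (10 / 9) := by
      rw [← Real.log_mul (by norm_num) (by norm_num)]; norm_num
    have := Real.log_le_sub_one_of_pos (x := 10 / 9) (by norm_num)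
    linarith
  have hub (l : κ) (hl : l ∈ J) : τ l ≤ 6.8 := by
    have h1 := Finset.single_le_sum (fun l _ => hg0 l) hl
    have h2 : Real.log ((1 + τ l) / 2) ≤ (1 + τ l) / 4 - 1 + Real.log 2 := by
      have h3 := Real.log_le_sub_one_of_pos (x := (1 + τ l) / 4) (by linarith [hpos l])
      have h4 : Real.log ((1 + τ l) / 2) = Real.log ((1 + τ l) / 4) + Real.log 2 := by
        rw [← Real.log_mul (by linarith [hpos l]) two_ne_zero]
        congr 1; ring
      linarith
    nlinarith
  calc ∑ l, τ l * Real.log (τ l) = ∑ l ∈ J, τ l * Real.log (τ l) := by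
        refine (Finset.sum_subset (Finset.subset_univ J) fun l _ hl => ?_).symm
        simp only [hJ, Finset.mem_filter, Finset.mem_univ, true_and, not_not] at hl
        rw [hl, zero_mul]
    _ ≤ ∑ l ∈ J, ((τ l - 1) + 6 * ((τ l - 1) / 2 - Real.log ((1 + τ l) / 2))) :=
        Finset.sum_le_sum fun l hl => by
          have := Real.mul_log_sub_add_one_le (h0 l) (hub l hl)
          linarith
    _ ≤ (d - J.card) + 6 * ((d - J.card) * (1 / 2 - Real.log 2) + Real.log (20 / 9)) := by
        rw [Finset.sum_add_distrib, ← Finset.mul_sum, Finset.sum_sub_distrib, hsumJ]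
        simp only [Finset.sum_const, nsmul_eq_mul, mul_one]
        linarith
    _ ≤ _ := by nlinarith

section
variable {m : Type*} [Fintype m] [DecidableEq m]

lemma Matrix.IsHermitian.dotProduct_mulVec_eq_sum {A : Matrix m m ℂ} (hA : A.IsHermitian)
    (v : EuclideanSpace ℂ m) : (star v.ofLp ⬝ᵥ (A *ᵥ v.ofLp)).re =
      ∑ l, ‖inner ℂ (hA.eigenvectorBasis l) v‖ ^ 2 * hA.eigenvalues l := by
  have h1 (l : m) : inner ℂ (hA.eigenvectorBasis l) (WithLp.toLp 2 (A *ᵥ v.ofLp)) =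
      hA.eigenvalues l * inner ℂ (hA.eigenvectorBasis l) v := by
    have h := (isSymmetric_toEuclideanLin_iff.2 hA) (hA.eigenvectorBasis l) v
    rw [toLpLin_apply, toLpLin_apply, hA.mulVec_eigenvectorBasis] at h
    rw [← h, WithLp.toLp_smul, WithLp.toLp_ofLp]
    simp
  have h2 : star v.ofLp ⬝ᵥ (A *ᵥ v.ofLp) = inner ℂ v (WithLp.toLp 2 (A *ᵥ v.ofLp)) := by
    rw [EuclideanSpace.inner_eq_star_dotProduct, dotProduct_comm]
  rw [h2, ← hA.eigenvectorBasis.sum_inner_mul_inner, Complex.re_sum]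
  refine Finset.sum_congr rfl fun l _ => ?_
  rw [h1, ← inner_conj_symm v, mul_left_comm, Complex.conj_mul', Complex.re_ofReal_mul, mul_comm]
  norm_cast

/-- Convexity of `A ↦ Tr (A log A)` on positive semidefinite matrices. -/
lemma sum_mul_log_eigenvalues_le {κ : Type*} [Fintype κ] {p : κ → ℝ} (hp : ∀ k, 0 ≤ p k)
    (hp1 : ∑ k, p k = 1) {σ : κ → Matrix m m ℂ} (hσ : ∀ k, (σ k).PosSemidef)
    {A : Matrix m m ℂ} (hA : A.IsHermitian) {c : ℝ} (hAσ : (c : ℂ) • A = ∑ k, (p k : ℂ) • σ k) :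
    ∑ j, c * hA.eigenvalues j * Real.log (c * hA.eigenvalues j) ≤
      ∑ k, p k * ∑ l, (hσ k).isHermitian.eigenvalues l *
        Real.log ((hσ k).isHermitian.eigenvalues l) := by
  set w : m → κ × m → ℝ := fun j q =>
    p q.1 * ‖inner ℂ ((hσ q.1).isHermitian.eigenvectorBasis q.2) (hA.eigenvectorBasis j)‖ ^ 2
  have hw0 (j : m) (q : κ × m) : 0 ≤ w j q := mul_nonneg (hp _) (by positivity)
  have hw1 (j : m) : ∑ q, w j q = 1 := by
    simp only [w, Fintype.sum_prod_type, ← Finset.mul_sum]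
    rw [← hp1]
    refine Finset.sum_congr rfl fun k _ => ?_
    rw [(hσ k).isHermitian.eigenvectorBasis.sum_sq_norm_inner_right]
    simp
  have heig (j : m) : c * hA.eigenvalues j =
      ∑ q : κ × m, w j q • (hσ q.1).isHermitian.eigenvalues q.2 := by
    rw [hA.eigenvalues_eq, Fintype.sum_prod_type, RCLike.re_to_complex, ← Complex.re_ofReal_mul,
      ← smul_eq_mul, ← dotProduct_smul, ← smul_mulVec, hAσ, sum_mulVec, dotProduct_sum,
      Complex.re_sum]
    refine Finset.sum_congr rfl fun k _ => ?_
    rw [smul_mulVec, dotProduct_smul, smul_eq_mul, Complex.re_ofReal_mul,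
      (hσ k).isHermitian.dotProduct_mulVec_eq_sum, Finset.mul_sum]
    refine Finset.sum_congr rfl fun l _ => ?_
    simp only [w, smul_eq_mul]
    ring
  have hJ (j : m) : c * hA.eigenvalues j * Real.log (c * hA.eigenvalues j) ≤
      ∑ q : κ × m, w j q • ((hσ q.1).isHermitian.eigenvalues q.2 *
        Real.log ((hσ q.1).isHermitian.eigenvalues q.2)) := by
    rw [heig j]
    exact Real.convexOn_mul_log.map_sum_le (fun q _ => hw0 j q) (hw1 j)
      fun q _ => (hσ q.1).eigenvalues_nonneg q.2
  refine (Finset.sum_le_sum fun j _ => hJ j).trans_eq ?_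
  rw [Finset.sum_comm, Fintype.sum_prod_type]
  refine Finset.sum_congr rfl fun k _ => ?_
  rw [Finset.mul_sum]
  refine Finset.sum_congr rfl fun l _ => ?_
  simp only [w, smul_eq_mul, ← Finset.sum_mul, ← Finset.mul_sum]
  rw [hA.eigenvectorBasis.sum_sq_norm_inner_left]
  simp

lemma Matrix.IsHermitian.eq_sum_vecMulVec {A : Matrix m m ℂ} (hA : A.IsHermitian) :
    A = ∑ k, (hA.eigenvalues k : ℂ) • vecMulVec (hA.eigenvectorBasis k).ofLp
      (star (hA.eigenvectorBasis k).ofLp) := by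
  conv_lhs => rw [hA.spectral_theorem, Unitary.conjStarAlgAut_apply]
  ext a b
  rw [Matrix.mul_apply, Matrix.sum_apply]
  refine Finset.sum_congr rfl fun k _ => ?_
  rw [mul_diagonal]
  simp [vecMulVec_apply, Matrix.star_apply]
  ring

lemma Matrix.IsHermitian.det_one_add {A : Matrix m m ℂ} (hA : A.IsHermitian) :
    (1 + A).det = ((∏ l, (1 + hA.eigenvalues l) : ℝ) : ℂ) := by
  have h := congrArg (Polynomial.eval (-1)) hA.charpoly_eq
  rw [eval_charpoly, Polynomial.eval_prod] at h
  have e : (scalar m (-1 : ℂ)) - A = -(1 + A) := by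
    rw [map_neg, map_one]; abel
  rw [e, det_neg] at h
  have e2 : ∏ l, Polynomial.eval (-1 : ℂ) (Polynomial.X - Polynomial.C (hA.eigenvalues l : ℂ)) =
      (-1) ^ Fintype.card m * ∏ l, (1 + (hA.eigenvalues l : ℂ)) := by
    rw [← Finset.card_univ, ← Finset.prod_const, ← Finset.prod_mul_distrib]
    refine Finset.prod_congr rfl fun l _ => ?_
    simp; ring
  have h3 := h.trans e2
  rw [mul_right_inj' (pow_ne_zero _ (by norm_num))] at h3
  rw [h3]
  push_cast
  rfl

end

lemma sum_mul_log_eigenvalues_frame_le {m ι : Type*} [Fintype m] [DecidableEq m] [Fintype ι]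
    [DecidableEq ι] {v : ι → EuclideanSpace ℂ m} (hv : ∀ i, ‖v i‖ = 1)
    (hdet : 9 / 20 < ((1 / 2 : ℂ) • (1 + gram ℂ v)).det.re) {M : Matrix m ι ℂ}
    (hM : ∀ a i, M a i = v i a) (hσ : (M * Mᴴ).PosSemidef) :
    ∑ l, hσ.isHermitian.eigenvalues l * Real.log (hσ.isHermitian.eigenvalues l) ≤
      6 * Real.log (20 / 9) := by
  have hgram : Mᴴ * M = gram ℂ v := by
    ext i j
    rw [gram_apply, EuclideanSpace.inner_eq_star_dotProduct, Matrix.mul_apply]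
    simp [dotProduct, hM, mul_comm]
  refine sum_mul_log_le_of_le_prod hσ.eigenvalues_nonneg (d := Fintype.card ι) ?_ ?_ ?_
  · have h1 : ((∑ l, hσ.isHermitian.eigenvalues l : ℝ) : ℂ) = Fintype.card ι := by
      have := hσ.isHermitian.trace_eq_sum_eigenvalues
      rw [trace_mul_comm, hgram] at this
      push_cast
      rw [← Complex.coe_algebraMap, ← this]
      simp [trace, inner_self_eq_norm_sq_to_K, hv]
    exact_mod_cast h1
  · rw [← Fintype.card_subtype, ← hσ.isHermitian.rank_eq_card_non_zero_eigs]
    exact (rank_mul_le_left _ _).trans (rank_le_card_width _)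
  · have h1 := hσ.isHermitian.det_one_add
    rw [det_one_add_mul_comm, hgram] at h1
    rw [det_smul, h1] at hdet
    have h2 : ((1 / 2 : ℂ) ^ Fintype.card ι *
        ((∏ l, (1 + hσ.isHermitian.eigenvalues l) : ℝ) : ℂ)).re =
        (1 / 2) ^ Fintype.card ι * ∏ l, (1 + hσ.isHermitian.eigenvalues l) := by
      rw [← Complex.ofReal_re ((1 / 2) ^ Fintype.card ι * _)]
      push_cast
      rfl
    rw [h2, _root_.one_div_pow, one_div_mul_eq_div, lt_div_iff₀ (by positivity)] at hdet
    exact hdet.le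

lemma log_sub_le_vnEntropy_ruChannel {d n : ℕ} (hd : 0 < d) (V : UnitaryTuple (Fin d) n)
    (hV : ∀ y, ‖y‖ = 1 → 9 / 20 < ((1 / 2 : ℂ) • (1 + gram ℂ (V.orbit y))).det.re)
    {ρ : Matrix (Fin n) (Fin n) ℂ} (hρ : ρ.PosSemidef) (htr : ρ.trace = 1) :
    Real.log d - 6 * Real.log (20 / 9) / d ≤
      vnEntropy (ruChannel (fun _ => 1 / d) (fun i => ((V i)⁻¹).1) ρ) := by
  have hd0 : (0 : ℝ) < d := by exact_mod_cast hd
  set U : Fin d → Matrix (Fin n) (Fin n) ℂ := fun i => ((V i)⁻¹).1 with hU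
  set B := ruChannel (fun _ => 1 / d) U ρ with hB
  have hBh : B.IsHermitian := by
    rw [hB, ruChannel, Matrix.IsHermitian, conjTranspose_sum]
    refine Finset.sum_congr rfl fun i _ => ?_
    rw [conjTranspose_smul, (isHermitian_mul_mul_conjTranspose _ hρ.isHermitian).eq]
    simp
  have hBtr : ∑ j, hBh.eigenvalues j = 1 := by
    have h1 : B.trace = 1 := by
      rw [hB, ruChannel, trace_sum]
      have (i : Fin d) : (((1 / d : ℝ) : ℂ) • (U i * ρ * (U i)ᴴ)).trace = 1 / d := by
        have hu : (U i)ᴴ * U i = 1 := Unitary.star_mul_self_of_mem ((V i)⁻¹).2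
        rw [trace_smul, trace_mul_comm, ← Matrix.mul_assoc, hu, Matrix.one_mul, htr]
        simp
      rw [Finset.sum_congr rfl fun i _ => this i]
      have : (d : ℂ) ≠ 0 := by exact_mod_cast hd.ne'
      simp [this]
    rw [hBh.trace_eq_sum_eigenvalues] at h1
    have h2 : ((∑ j, hBh.eigenvalues j : ℝ) : ℂ) = 1 := by
      rw [← h1]; push_cast; rfl
    exact_mod_cast h2
  set p := hρ.isHermitian.eigenvalues with hp
  have hp1 : ∑ k, p k = 1 := by
    rw [hρ.isHermitian.trace_eq_sum_eigenvalues] at htr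
    have h2 : ((∑ k, p k : ℝ) : ℂ) = 1 := by
      rw [← htr]; push_cast; rfl
    exact_mod_cast h2
  set x := hρ.isHermitian.eigenvectorBasis with hx
  set M : Fin n → Matrix (Fin n) (Fin d) ℂ := fun k => Matrix.of fun a i => V.orbit (x k) i a
    with hM
  have hσ (k : Fin n) : (M k * (M k)ᴴ).PosSemidef := posSemidef_self_mul_conjTranspose _
  have hpure (k : Fin n) : M k * (M k)ᴴ =
      ∑ i, U i * vecMulVec (x k).ofLp (star (x k).ofLp) * (U i)ᴴ := by
    ext a b
    rw [Matrix.mul_apply, Matrix.sum_apply]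
    refine Finset.sum_congr rfl fun i _ => ?_
    rw [mul_vecMulVec, vecMulVec_mul, vecMulVec_apply, ← star_mulVec]
    rfl
  have hdec : ((d : ℝ) : ℂ) • B = ∑ k, (p k : ℂ) • (M k * (M k)ᴴ) := by
    have hd' : (d : ℂ) ≠ 0 := by exact_mod_cast hd.ne'
    have h1 : ((d : ℝ) : ℂ) • B = ∑ i, U i * ρ * (U i)ᴴ := by
      rw [hB, ruChannel, Finset.smul_sum]
      refine Finset.sum_congr rfl fun i _ => ?_
      rw [smul_smul]
      simp [hd']
    rw [h1]
    simp only [hpure, Finset.smul_sum]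
    rw [Finset.sum_comm]
    refine Finset.sum_congr rfl fun i _ => ?_
    conv_lhs => rw [hρ.isHermitian.eq_sum_vecMulVec]
    rw [Matrix.mul_sum, Matrix.sum_mul]
    refine Finset.sum_congr rfl fun k _ => ?_
    rw [Matrix.mul_smul, Matrix.smul_mul]
  have hmain := sum_mul_log_eigenvalues_le hρ.eigenvalues_nonneg hp1 hσ hBh hdec
  have hle : ∑ k, p k * ∑ l, (hσ k).isHermitian.eigenvalues l *
        Real.log ((hσ k).isHermitian.eigenvalues l) ≤ 6 * Real.log (20 / 9) := by
    calc _ ≤ ∑ k, p k * (6 * Real.log (20 / 9)) := Finset.sum_le_sum fun k _ =>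
          mul_le_mul_of_nonneg_left (sum_mul_log_eigenvalues_frame_le
            (v := V.orbit (x k)) (fun i => by simp) (hV _ (by simp)) (fun a i => rfl) (hσ k))
            (hρ.eigenvalues_nonneg k)
      _ = _ := by rw [← Finset.sum_mul, hp1, one_mul]
  have hscale : ∑ j, d * hBh.eigenvalues j * Real.log (d * hBh.eigenvalues j) =
      d * Real.log d + d * ∑ j, hBh.eigenvalues j * Real.log (hBh.eigenvalues j) := by
    rw [← mul_one (d * Real.log d), ← hBtr, Finset.mul_sum, Finset.mul_sum,
      ← Finset.sum_add_distrib]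
    refine Finset.sum_congr rfl fun j _ => ?_
    by_cases h : hBh.eigenvalues j = 0
    · simp [h]
    · rw [Real.log_mul hd0.ne' h]; ring
  have hfin := hmain.trans hle
  rw [hscale] at hfin
  rw [vnEntropy, dif_pos hBh, sub_le_iff_le_add, ← sub_le_iff_le_add', le_div_iff₀ hd0]
  linarith

/-- There is a random unitary channel with environment dimension `d < 3.9 × 10⁴` whose
minimal output entropy exceeds `log d − (log d)/(2d)`. -/
theorem exists_channel_d_lt :
    ∃ (d n : ℕ) (w : Fin d → ℝ) (U : Fin d → Matrix (Fin n) (Fin n) ℂ),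
      0 < d ∧ d < 39000 ∧ 0 < n ∧
      (∀ i, 0 ≤ w i) ∧ ∑ i, w i = 1 ∧
      (∀ i, U i ∈ Matrix.unitaryGroup (Fin n) ℂ) ∧
      Real.log d - Real.log d / (2 * d) < minOutEntropy (ruChannel w U) := by
  obtain ⟨d, hd⟩ : ∃ d : ℕ, d = 2 ^ 15 := ⟨_, rfl⟩
  have hd0 : 0 < d := by rw [hd]; positivity
  have hdR : (0 : ℝ) < d := by exact_mod_cast hd0
  obtain ⟨n, hn, V, hV⟩ := UnitaryTuple.exists_forall_lt_det (ι := Fin d) (c := 9 / 20)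
    (by norm_num)
  refine ⟨d, n, fun _ => 1 / d, fun i => ((V i)⁻¹).1, hd0, by rw [hd]; norm_num, hn,
    fun _ => by positivity, by simp [hdR.ne'], fun i => ((V i)⁻¹).2, ?_⟩
  have hlog : Real.log d = 15 * Real.log 2 := by rw [hd, Nat.cast_pow, Real.log_pow]; norm_num
  have hL : 6 * Real.log (20 / 9) < Real.log d / 2 := by
    have h1 : Real.log (20 / 9) = Real.log 2 + Real.log (10 / 9) := by
      rw [← Real.log_mul (by norm_num) (by norm_num)]; norm_num
    have h2 : 4 * Real.log (10 / 9) < Real.log 2 := by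
      have := Real.log_lt_log (by norm_num) (show ((10 : ℝ) / 9) ^ 4 < 2 by norm_num)
      rw [Real.log_pow] at this
      exact_mod_cast this
    rw [hlog, h1]
    linarith
  refine lt_of_lt_of_le (b := Real.log d - 6 * Real.log (20 / 9) / d) ?_ (le_csInf ?_ ?_)
  · rw [← div_div]
    gcongr
  · have : NeZero n := ⟨hn.ne'⟩
    refine ⟨_, vecMulVec (Pi.single 0 1) (star (Pi.single 0 1)),
      posSemidef_vecMulVec_self_star _, ?_, rfl⟩
    simp [trace_vecMulVec]
  · rintro _ ⟨ρ, hρ, htr, rfl⟩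
    exact log_sub_le_vnEntropy_ruChannel hd0 V hV hρ htr
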